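/- arXiv:math/0701038 — 2 statements merged into one kernel-verified Lean document; each statement's English description precedes it below -/
import Mathlib

section
/- Up to isomorphism there are exactly 35 normal 3-pseudomanifolds on 8 vertices which are not combinatorial 3-manifolds; that is, there exist 35 pairwise non-isomorphic normal 3-pseudomanifolds with exactly 8 vertices, none of which is a combinatorial 3-manifold, such that every normal 3-pseudomanifold with exactly 8 vertices that is not a combinatorial 3-manifold is isomorphic to one of them. -/
/-! Basic framework for finite simplicial complexes, pseudomanifolds and
bistellar moves, following Datta–Nilakantan. A complex is recorded as the
finite set of its faces (nonempty finite subsets of the vertex type). -/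

namespace NPM

variable {α β : Type*} [DecidableEq α] [DecidableEq β]

/-- A "complex" datum: a finite family of finite subsets of `α`. -/
abbrev Complex (α : Type*) := Finset (Finset α)

/-- `K` is a simplicial complex: a nonempty collection of nonempty sets,
closed under passing to nonempty subsets. -/
def IsComplex (K : Complex α) : Prop :=
  K.Nonempty ∧ (∀ σ ∈ K, σ.Nonempty) ∧ ∀ σ ∈ K, ∀ τ ⊆ σ, τ.Nonempty → τ ∈ K

/-- The vertex set of `K`. -/
def verts (K : Complex α) : Finset α := K.sup id

/-- `K` is pure of dimension `d`: every face is contained in a face with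
`d+1` vertices. -/
def IsPure (K : Complex α) (d : ℕ) : Prop :=
  ∀ σ ∈ K, ∃ τ ∈ K, σ ⊆ τ ∧ τ.card = d + 1

/-- The facets ("`d`-faces") of a pure `d`-dimensional complex. -/
def facets (K : Complex α) (d : ℕ) : Complex α := K.filter (fun σ => σ.card = d + 1)

/-- The link of a face `σ` in `K`. -/
def link (K : Complex α) (σ : Finset α) : Complex α :=
  K.filter (fun τ => Disjoint τ σ ∧ σ ∪ τ ∈ K)

/-- The degree of a face: the number of vertices of its link. -/
def degree (K : Complex α) (σ : Finset α) : ℕ := (verts (link K σ)).card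

/-- A weak `d`-pseudomanifold: a pure `d`-dimensional complex in which every
`(d-1)`-face (i.e. face with `d` vertices) lies in exactly two facets. -/
def WeakPM (K : Complex α) (d : ℕ) : Prop :=
  IsComplex K ∧ IsPure K d ∧
    ∀ σ ∈ K, σ.card = d → (K.filter fun τ => σ ⊆ τ ∧ τ.card = d + 1).card = 2

/-- Strong connectedness: any two facets are joined by a chain of facets in
which consecutive facets meet in a `(d-1)`-face. -/
def SConn (K : Complex α) (d : ℕ) : Prop :=
  ∀ σ ∈ facets K d, ∀ τ ∈ facets K d,
    Relation.ReflTransGen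
      (fun a b => a ∈ facets K d ∧ b ∈ facets K d ∧ (a ∩ b).card = d) σ τ

/-- A `d`-pseudomanifold: a strongly connected weak `d`-pseudomanifold. -/
def IsPM (K : Complex α) (d : ℕ) : Prop := WeakPM K d ∧ SConn K d

/-- Connectedness of a complex: the graph of vertices and edges is connected. -/
def Conn (K : Complex α) : Prop :=
  (verts K).Nonempty ∧ ∀ u ∈ verts K, ∀ v ∈ verts K,
    Relation.ReflTransGen (fun a b => a ≠ b ∧ ({a, b} : Finset α) ∈ K) u v

/-- A normal `d`-pseudomanifold: a connected weak `d`-pseudomanifold in which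
the link of every face of dimension `≤ d - 2` is connected. -/
def NormalPM (K : Complex α) (d : ℕ) : Prop :=
  WeakPM K d ∧ Conn K ∧ ∀ σ ∈ K, σ.card + 1 ≤ d → Conn (link K σ)

/-- `K` is neighbourly: every pair of vertices forms an edge. -/
def Neighbourly (K : Complex α) : Prop :=
  ∀ u ∈ verts K, ∀ v ∈ verts K, u ≠ v → ({u, v} : Finset α) ∈ K

/-- Isomorphism of complexes: a map injective on the vertex set carrying the
faces of `K` exactly onto the faces of `L`. -/
def Iso (K : Complex α) (L : Complex β) : Prop :=
  ∃ f : α → β, Set.InjOn f ↑(verts K) ∧ L = K.image (fun σ => σ.image f)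

/-- The complex generated by a family of facets: all nonempty subsets. -/
def genCx (F : Finset (Finset α)) : Complex α :=
  F.biUnion fun σ => σ.powerset.filter (fun τ => τ.Nonempty)

/-- The standard sphere on the vertex set `B`: all nonempty proper subsets
of `B`. -/
def stdSphere (B : Finset α) : Complex α :=
  B.powerset.filter fun τ => τ.Nonempty ∧ τ ≠ B

/-- In a weak `d`-pseudomanifold, a removable `(d-i)`-face `A`: its link is a
standard sphere `S^{i-1}_{i+1}(B)` with `B` not a face.  (For `d = 3`,
`i = 1` gives removable 2-faces and `i = 2` gives removable 1-faces.) -/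
def RemovableFace (d i : ℕ) (K : Complex α) (A : Finset α) : Prop :=
  A ∈ K ∧ A.card = d - i + 1 ∧
    ∃ B : Finset α, B.card = i + 1 ∧ B ∉ K ∧ link K A = stdSphere B

/-- The bistellar `i`-move (`0 < i ≤ d`) relation on weak `d`-pseudomanifolds:
`L` is obtained from `K` by removing a removable `(d-i)`-face `A` with
`link K A = stdSphere B` and inserting the facets `(B ∪ A) \ {v}`, `v ∈ A`. -/
def BMove (d i : ℕ) (K L : Complex α) : Prop :=
  ∃ A B : Finset α, A ∈ K ∧ A.card = d - i + 1 ∧ B.card = i + 1 ∧ B ∉ K ∧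
    link K A = stdSphere B ∧
    L = genCx ((facets K d).filter (fun σ => ¬ A ⊆ σ) ∪
          A.image fun v => (B ∪ A).erase v)

/-- The bistellar `0`-move: star a new vertex `w` in a facet `σ`. -/
def BMove0 (d : ℕ) (K L : Complex α) : Prop :=
  ∃ σ w, σ ∈ K ∧ σ.card = d + 1 ∧ w ∉ verts K ∧
    L = genCx (((facets K d).erase σ) ∪ σ.image fun v => insert w (σ.erase v))

/-- A single bistellar move of any type `0 ≤ i ≤ d`. -/
def BStep (d : ℕ) (K L : Complex α) : Prop :=
  BMove0 d K L ∨ ∃ i, 0 < i ∧ i ≤ d ∧ BMove d i K L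

/-- Bistellar equivalence: a finite sequence of bistellar moves. -/
def BEquiv (d : ℕ) : Complex α → Complex α → Prop :=
  Relation.ReflTransGen (BStep d)

/-- A proper bistellar move: a bistellar `i`-move with `0 < i < d`. -/
def PMove (d : ℕ) (K L : Complex α) : Prop := ∃ i, 0 < i ∧ i < d ∧ BMove d i K L

/-- Proper bistellar equivalence. -/
def PEquiv (d : ℕ) : Complex α → Complex α → Prop :=
  Relation.ReflTransGen (PMove d)

/-- The result of the bistellar move on the face `A` of the weak
`d`-pseudomanifold `K` (deterministic form: `B` is the vertex set of
`link K A`). -/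
def kappa (d : ℕ) (K : Complex α) (A : Finset α) : Complex α :=
  genCx ((facets K d).filter (fun σ => ¬ A ⊆ σ) ∪
    A.image fun v => (verts (link K A) ∪ A).erase v)

/-- A cycle: a (finite) 1-pseudomanifold. -/
def Cycle (K : Complex α) : Prop := IsPM K 1

/-- A combinatorial 2-manifold: a weak 2-pseudomanifold all whose vertex
links are cycles. -/
def Comb2Mfd (K : Complex α) : Prop :=
  WeakPM K 2 ∧ ∀ v, ({v} : Finset α) ∈ K → Cycle (link K {v})

/-- The Euler characteristic `f₀ - f₁ + f₂` of a 2-dimensional complex. -/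
def eulerChar (K : Complex α) : ℤ :=
  ((K.filter fun σ => σ.card = 1).card : ℤ) -
    ((K.filter fun σ => σ.card = 2).card : ℤ) +
    ((K.filter fun σ => σ.card = 3).card : ℤ)

/-- A combinatorial 2-sphere: a connected combinatorial 2-manifold with
Euler characteristic 2. -/
def Comb2Sphere (K : Complex α) : Prop := Comb2Mfd K ∧ Conn K ∧ eulerChar K = 2

/-- A combinatorial 3-manifold: a 3-pseudomanifold all whose vertex links are
combinatorial 2-spheres. -/
def Comb3Mfd (K : Complex α) : Prop :=
  IsPM K 3 ∧ ∀ v, ({v} : Finset α) ∈ K → Comb2Sphere (link K {v})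

end NPM

namespace NPM

/-- The positions of the binary digits `1` of `s`. -/
def digits (s : ℕ) : List ℕ := (List.range (s.log2 + 1)).filter s.testBit

/-- The set with characteristic number `s`. -/
def bits (s : ℕ) : Finset ℕ := (digits s).toFinset

/-- The characteristic number of the set of entries of a list. -/
def mask : List ℕ → ℕ
  | [] => 0
  | i :: l => 1 <<< i ||| mask l

/-- Inclusion of sets given by their characteristic numbers. -/
def sub (s t : ℕ) : Bool := (s &&& t).beq s

/-- Disjointness of sets given by their characteristic numbers. -/
def dis (s t : ℕ) : Bool := (s &&& t).beq 0

/-- The family of sets obtained from `s` by deleting one element. -/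
def ridges (s : ℕ) : ℕ := mask ((digits s).map fun i => s ^^^ 1 <<< i)

/-- The image of the set `s` under the map `i ↦ q[i]`. -/
def relabel : List ℕ → ℕ → ℕ
  | [], _ => 0
  | a :: q, s => (s % 2) <<< a ||| relabel q (s / 2)

theorem mem_digits {s i : ℕ} : i ∈ digits s ↔ s.testBit i = true := by
  simp only [digits, List.mem_filter, List.mem_range, and_iff_right_iff_imp]
  intro h
  have h2 := Nat.ge_two_pow_of_testBit h
  have h0 : s ≠ 0 := by rintro rfl; simp at h
  exact Nat.lt_succ_of_le ((Nat.le_log2 h0).2 h2)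

theorem mem_bits {s i : ℕ} : i ∈ bits s ↔ s.testBit i = true := by
  simp [bits, mem_digits]

theorem nodup_digits (s : ℕ) : (digits s).Nodup := List.nodup_range.filter _

theorem card_bits (s : ℕ) : (bits s).card = (digits s).length :=
  List.toFinset_card_of_nodup (nodup_digits s)

theorem bits_injective : Function.Injective bits := fun s t h =>
  Nat.eq_of_testBit_eq fun i => by rw [Bool.eq_iff_iff, ← mem_bits, ← mem_bits, h]

theorem bits_zero : bits 0 = ∅ := by ext i; simp [mem_bits]

theorem bits_nonempty {s : ℕ} : (bits s).Nonempty ↔ s ≠ 0 := by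
  rw [Finset.nonempty_iff_ne_empty, ← bits_zero, bits_injective.ne_iff]

theorem bits_subset_range {s n : ℕ} : bits s ⊆ Finset.range n ↔ s < 2 ^ n := by
  constructor
  · intro h
    refine Nat.lt_pow_two_of_testBit s fun i hi => ?_
    by_contra hc
    have := h (mem_bits.2 (by simpa using hc))
    simp at this; omega
  · intro h i hi
    by_contra hc
    have hni : 2 ^ n ≤ 2 ^ i := Nat.pow_le_pow_right two_pos (by simpa using hc)
    rw [mem_bits, Nat.testBit_lt_two_pow (h.trans_le hni)] at hi
    simp at hi

theorem testBit_shift {i j : ℕ} : (1 <<< i).testBit j = true ↔ j = i := by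
  rw [Nat.one_shiftLeft, Nat.testBit_two_pow]; simp [eq_comm]

theorem testBit_mask {l : List ℕ} {i : ℕ} : (mask l).testBit i = true ↔ i ∈ l := by
  induction l with
  | nil => simp [mask]
  | cons a l ih => simp [mask, Nat.testBit_or, testBit_shift, ih, -Nat.testBit_shiftLeft]

theorem mask_eq_mask {l m : List ℕ} : mask l = mask m ↔ ∀ i, i ∈ l ↔ i ∈ m := by
  refine ⟨fun h i => by rw [← testBit_mask, h, testBit_mask],
    fun h => Nat.eq_of_testBit_eq fun i => ?_⟩
  rw [Bool.eq_iff_iff, testBit_mask, testBit_mask, h]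

theorem exists_bits (T : Finset ℕ) : ∃ s, bits s = T :=
  ⟨mask T.toList, by ext i; simp [mem_bits, testBit_mask]⟩

theorem sub_iff_testBit {s t : ℕ} :
    sub s t = true ↔ ∀ i, s.testBit i = true → t.testBit i = true := by
  rw [sub, Nat.beq_eq]
  constructor
  · intro h i hi
    rw [← h, Nat.testBit_and] at hi
    simp_all
  · intro h
    refine Nat.eq_of_testBit_eq fun i => ?_
    rw [Nat.testBit_and]
    have := h i
    revert this
    cases s.testBit i <;> simp

theorem sub_iff {s t : ℕ} : sub s t = true ↔ bits s ⊆ bits t := by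
  simp only [sub_iff_testBit, Finset.subset_iff, mem_bits]

theorem dis_iff_testBit {s t : ℕ} :
    dis s t = true ↔ ∀ i, s.testBit i = true → t.testBit i = true → False := by
  rw [dis, Nat.beq_eq]
  constructor
  · intro h i hi hj
    have := congrArg (Nat.testBit · i) h
    simp [Nat.testBit_and, hi, hj] at this
  · intro h
    refine Nat.eq_of_testBit_eq fun i => ?_
    rw [Nat.testBit_and]
    have := h i
    revert this
    cases s.testBit i <;> cases t.testBit i <;> simp

theorem dis_iff {s t : ℕ} : dis s t = true ↔ Disjoint (bits s) (bits t) := by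
  simp only [dis_iff_testBit, Finset.disjoint_left, mem_bits]

theorem bits_and (s t : ℕ) : bits (s &&& t) = bits s ∩ bits t := by
  ext i; simp [mem_bits, Nat.testBit_and]

theorem bits_or (s t : ℕ) : bits (s ||| t) = bits s ∪ bits t := by
  ext i; simp [mem_bits, Nat.testBit_or]

theorem bits_xor_of_subset {s t : ℕ} (h : bits t ⊆ bits s) : bits (s ^^^ t) = bits s \ bits t := by
  ext i
  have := @h i
  simp only [mem_bits, Nat.testBit_xor, Finset.mem_sdiff] at this ⊢
  revert this
  cases s.testBit i <;> cases t.testBit i <;> simp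

theorem bits_shift (i : ℕ) : bits (1 <<< i) = {i} := by
  ext j; simp only [mem_bits, testBit_shift, Finset.mem_singleton]

theorem testBit_ridges {s t : ℕ} : (ridges s).testBit t = true ↔
    bits t ⊆ bits s ∧ (bits t).card + 1 = (bits s).card := by
  rw [ridges, testBit_mask, ← Finset.exists_eq_insert_iff]
  simp only [List.mem_map, mem_digits, ← mem_bits]
  constructor
  · rintro ⟨i, hi, rfl⟩
    refine ⟨i, ?_⟩
    rw [bits_xor_of_subset (by simpa [bits_shift] using hi), bits_shift,
      Finset.sdiff_singleton_eq_erase]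
    exact ⟨by simp, Finset.insert_erase hi⟩
  · rintro ⟨i, hi, h⟩
    have hs : i ∈ bits s := by rw [← h]; simp
    refine ⟨i, hs, bits_injective ?_⟩
    rw [bits_xor_of_subset (by simpa [bits_shift] using hs), bits_shift,
      Finset.sdiff_singleton_eq_erase, ← h, Finset.erase_insert hi]

theorem testBit_relabel {q : List ℕ} {s j : ℕ} : (relabel q s).testBit j = true ↔
    ∃ i < q.length, s.testBit i = true ∧ q.getD i 0 = j := by
  induction q generalizing s with
  | nil => simp [relabel]
  | cons a q ih =>
    have h : ((s % 2) <<< a).testBit j = true ↔ s.testBit 0 = true ∧ a = j := by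
      rw [Nat.testBit_zero]
      rcases Nat.mod_two_eq_zero_or_one s with h | h
      · simp [h]
      · rw [h, testBit_shift]; simp [eq_comm]
    rw [relabel, Nat.testBit_or, Bool.or_eq_true, h, ih]
    constructor
    · rintro (⟨h0, rfl⟩ | ⟨i, hi, hs, rfl⟩)
      · exact ⟨0, by simp, h0, by simp⟩
      · exact ⟨i + 1, by simpa using hi, by rwa [Nat.testBit_succ], by simp⟩
    · rintro ⟨_ | i, hi, hs, hq⟩
      · exact .inl ⟨hs, by simpa using hq⟩
      · exact .inr ⟨i, by simpa using hi, by rwa [Nat.testBit_succ] at hs, by simpa using hq⟩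

theorem bits_relabel {q : List ℕ} {s : ℕ} (h : s < 2 ^ q.length) :
    bits (relabel q s) = (bits s).image (q.getD · 0) := by
  ext j
  simp only [mem_bits, testBit_relabel, Finset.mem_image]
  have h' := bits_subset_range.2 h
  constructor
  · rintro ⟨i, -, hi⟩; exact ⟨i, hi⟩
  · rintro ⟨i, hi⟩; exact ⟨i, by simpa using h' (mem_bits.2 hi.1), hi⟩

theorem IsComplex.mem_of_subset {α : Type*} {K : Complex α} (hK : IsComplex K) {σ τ : Finset α}
    (hσ : σ ∈ K) (h : τ ⊆ σ) (hτ : τ.Nonempty) : τ ∈ K := hK.2.2 σ hσ τ h hτ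

section

variable {α : Type*} [DecidableEq α] {K : Complex α}

theorem mem_link {σ τ : Finset α} : τ ∈ link K σ ↔ τ ∈ K ∧ Disjoint τ σ ∧ σ ∪ τ ∈ K := by
  simp [link]

theorem IsComplex.mem_verts (hK : IsComplex K) {v : α} : v ∈ verts K ↔ {v} ∈ K := by
  simp only [verts, Finset.mem_sup, id]
  exact ⟨fun ⟨σ, hσ, hv⟩ => hK.mem_of_subset hσ (by simpa using hv) (by simp),
    fun h => ⟨{v}, h, by simp⟩⟩

theorem subset_verts {σ : Finset α} (hσ : σ ∈ K) : σ ⊆ verts K :=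
  Finset.le_sup (f := id) hσ

theorem IsComplex.mem_link (hK : IsComplex K) {σ τ : Finset α} :
    τ ∈ link K σ ↔ τ.Nonempty ∧ Disjoint τ σ ∧ σ ∪ τ ∈ K := by
  rw [NPM.mem_link]
  exact ⟨fun h => ⟨hK.2.1 _ h.1, h.2⟩,
    fun h => ⟨hK.mem_of_subset h.2.2 Finset.subset_union_right h.1, h.2⟩⟩

theorem IsComplex.mem_link_singleton (hK : IsComplex K) {v : α} {τ : Finset α} :
    τ ∈ link K {v} ↔ τ.Nonempty ∧ v ∉ τ ∧ insert v τ ∈ K := by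
  rw [hK.mem_link, Finset.disjoint_singleton_right, Finset.insert_eq]

theorem link_empty : link K ∅ = K := by
  ext τ
  rw [NPM.mem_link]
  simp

theorem IsComplex.link (hK : IsComplex K) {σ : Finset α} (h : (link K σ).Nonempty) :
    IsComplex (link K σ) := by
  refine ⟨h, fun τ hτ => (hK.mem_link.1 hτ).1, fun τ hτ ρ hρ hne => ?_⟩
  rw [hK.mem_link] at hτ ⊢
  exact ⟨hne, hτ.2.1.mono_left hρ,
    hK.mem_of_subset hτ.2.2 (Finset.union_subset_union_right hρ) (hne.mono Finset.subset_union_right)⟩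

theorem IsComplex.link_link (hK : IsComplex K) {v : α} {σ : Finset α} (hσ : σ ∈ NPM.link K {v}) :
    NPM.link (NPM.link K {v}) σ = NPM.link K (insert v σ) := by
  have hL := hK.link ⟨σ, hσ⟩
  have hσ' := hK.mem_link_singleton.1 hσ
  ext τ
  rw [hL.mem_link, hK.mem_link_singleton, hK.mem_link, Finset.disjoint_insert_right, Finset.insert_union]
  simp only [Finset.mem_union]
  have : (σ ∪ τ).Nonempty := hσ'.1.mono Finset.subset_union_left
  tauto

theorem Conn.nonempty (h : Conn K) : K.Nonempty := by
  rw [Finset.nonempty_iff_ne_empty]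
  rintro rfl
  simp [Conn, verts] at h

theorem WeakPM.link {d : ℕ} (h : WeakPM K (d + 1)) {v : α} (hne : (link K {v}).Nonempty) :
    WeakPM (link K {v}) d := by
  obtain ⟨hK, hp, hr⟩ := h
  refine ⟨hK.link hne, fun σ hσ => ?_, fun σ hσ hcard => ?_⟩
  · rw [hK.mem_link_singleton] at hσ
    obtain ⟨τ, hτ, hs, hc⟩ := hp _ hσ.2.2
    have hvτ : v ∈ τ := hs (by simp)
    have hsub : σ ⊆ τ.erase v := by
      rw [Finset.subset_erase]
      exact ⟨(Finset.subset_insert v σ).trans hs, hσ.2.1⟩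
    refine ⟨τ.erase v, hK.mem_link_singleton.2 ⟨hσ.1.mono hsub, by simp, ?_⟩, hsub, ?_⟩
    · rwa [Finset.insert_erase hvτ]
    · rw [Finset.card_erase_of_mem hvτ, hc]; rfl
  · have hσ' := hK.mem_link_singleton.1 hσ
    rw [← hr (insert v σ) hσ'.2.2 (by rw [Finset.card_insert_of_notMem hσ'.2.1, hcard])]
    refine Finset.card_nbij' (insert v) (·.erase v) ?_ ?_ ?_ ?_
    · intro τ hτ
      simp only [Finset.coe_filter, Set.mem_ofPred_eq, hK.mem_link_singleton] at hτ ⊢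
      refine ⟨hτ.1.2.2, Finset.insert_subset_insert v hτ.2.1, ?_⟩
      rw [Finset.card_insert_of_notMem hτ.1.2.1, hτ.2.2]
    · intro τ hτ
      simp only [Finset.coe_filter, Set.mem_ofPred_eq, hK.mem_link_singleton] at hτ ⊢
      have hvτ : v ∈ τ := hτ.2.1 (by simp)
      have hsub : σ ⊆ τ.erase v := by
        rw [Finset.subset_erase]
        exact ⟨(Finset.subset_insert v σ).trans hτ.2.1, hσ'.2.1⟩
      refine ⟨⟨hσ'.1.mono hsub, by simp, ?_⟩, hsub, ?_⟩
      · rw [Finset.insert_erase hvτ]; exact hτ.1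
      · rw [Finset.card_erase_of_mem hvτ, hτ.2.2]; rfl
    · intro τ hτ
      simp only [Finset.coe_filter, Set.mem_ofPred_eq, hK.mem_link_singleton] at hτ
      exact Finset.erase_insert hτ.1.2.1
    · intro τ hτ
      simp only [Finset.coe_filter, Set.mem_ofPred_eq] at hτ
      exact Finset.insert_erase (hτ.2.1 (by simp))

theorem NormalPM.link {d : ℕ} (h : NormalPM K (d + 2)) {v : α} (hv : {v} ∈ K) :
    NormalPM (link K {v}) (d + 1) := by
  have hc := h.2.2 {v} hv (by simp)
  refine ⟨h.1.link hc.nonempty, hc, fun σ hσ hcard => ?_⟩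
  rw [h.1.1.link_link hσ]
  have hσ' := h.1.1.mem_link_singleton.1 hσ
  refine h.2.2 _ hσ'.2.2 ?_
  rw [Finset.card_insert_of_notMem hσ'.2.1]
  omega

theorem sconn_zero (K : Complex α) : SConn K 0 := by
  intro σ hσ τ hτ
  by_cases h : σ = τ
  · exact h ▸ .refl
  · refine .single ⟨hσ, hτ, ?_⟩
    simp only [facets, Finset.mem_filter, zero_add, Finset.card_eq_one] at hσ hτ
    obtain ⟨-, a, rfl⟩ := hσ
    obtain ⟨-, b, rfl⟩ := hτ
    rw [Finset.singleton_inter_of_notMem (by simpa using h), Finset.card_empty]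

theorem sconn_of_link {d : ℕ} (hK : IsComplex K) (hp : IsPure K (d + 1)) (hc : Conn K)
    (hl : ∀ v, {v} ∈ K → SConn (link K {v}) d) : SConn K (d + 1) := by
  have key : ∀ v, ∀ σ ∈ facets K (d + 1), ∀ τ ∈ facets K (d + 1), v ∈ σ → v ∈ τ →
      Relation.ReflTransGen (fun a b => a ∈ facets K (d + 1) ∧ b ∈ facets K (d + 1) ∧
        (a ∩ b).card = d + 1) σ τ := by
    intro v σ hσ τ hτ hvσ hvτ
    have hvK : {v} ∈ K := hK.mem_of_subset (Finset.mem_filter.1 hσ).1 (by simpa using hvσ) (by simp)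
    have hmem : ∀ ρ ∈ facets K (d + 1), v ∈ ρ → ρ.erase v ∈ facets (link K {v}) d := by
      intro ρ hρ hv
      simp only [facets, Finset.mem_filter, hK.mem_link_singleton] at hρ ⊢
      have hcard : (ρ.erase v).card = d + 1 := by rw [Finset.card_erase_of_mem hv, hρ.2]; rfl
      refine ⟨⟨Finset.card_pos.1 (by omega), by simp, ?_⟩, hcard⟩
      rw [Finset.insert_erase hv]; exact hρ.1
    have hmem' : ∀ ρ ∈ facets (link K {v}) d, v ∉ ρ ∧ insert v ρ ∈ facets K (d + 1) := by
      intro ρ hρ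
      simp only [facets, Finset.mem_filter, hK.mem_link_singleton] at hρ ⊢
      exact ⟨hρ.1.2.1, hρ.1.2.2, by rw [Finset.card_insert_of_notMem hρ.1.2.1, hρ.2]⟩
    have h := (hl v hvK _ (hmem σ hσ hvσ) _ (hmem τ hτ hvτ)).lift (insert v)
      (p := fun a b => a ∈ facets K (d + 1) ∧ b ∈ facets K (d + 1) ∧ (a ∩ b).card = d + 1) ?_
    · simpa only [Function.onFun, Finset.insert_erase hvσ, Finset.insert_erase hvτ] using h
    · rintro a b ⟨ha, hb, hab⟩
      refine ⟨(hmem' a ha).2, (hmem' b hb).2, ?_⟩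
      rw [← Finset.insert_inter_distrib, Finset.card_insert_of_notMem, hab]
      simp [(hmem' a ha).1]
  have path : ∀ u w, Relation.ReflTransGen (fun a b => a ≠ b ∧ ({a, b} : Finset α) ∈ K) u w →
      ∀ σ ∈ facets K (d + 1), u ∈ σ → ∀ τ ∈ facets K (d + 1), w ∈ τ →
      Relation.ReflTransGen (fun a b => a ∈ facets K (d + 1) ∧ b ∈ facets K (d + 1) ∧
        (a ∩ b).card = d + 1) σ τ := by
    intro u w h σ hσ hu
    induction h with
    | refl => exact fun τ hτ hw => key u σ hσ τ hτ hu hw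
    | tail _ hbc ih =>
      intro τ hτ hw
      obtain ⟨ρ, hρ, hs, hcard⟩ := hp _ hbc.2
      have hρ' : ρ ∈ facets K (d + 1) := by simp [facets, hρ, hcard]
      exact (ih ρ hρ' (hs (by simp))).trans (key _ ρ hρ' τ hτ (hs (by simp)) hw)
  intro σ hσ τ hτ
  obtain ⟨hσK, hσc⟩ := Finset.mem_filter.1 hσ
  obtain ⟨hτK, hτc⟩ := Finset.mem_filter.1 hτ
  obtain ⟨u, hu⟩ := hK.2.1 σ hσK
  obtain ⟨w, hw⟩ := hK.2.1 τ hτK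
  exact path u w (hc.2 u (subset_verts hσK hu) w (subset_verts hτK hw)) σ hσ hu τ hτ hw

/-- Normal pseudomanifolds are strongly connected. -/
theorem NormalPM.sconn {d : ℕ} (h : NormalPM K (d + 1)) : SConn K (d + 1) := by
  induction d generalizing K with
  | zero => exact sconn_of_link h.1.1 h.1.2.1 h.2.1 fun v _ => sconn_zero _
  | succ d ih => exact sconn_of_link h.1.1 h.1.2.1 h.2.1 fun v hv => ih (h.link hv)

theorem NormalPM.comb2Mfd (h : NormalPM K 2) : Comb2Mfd K :=
  ⟨h.1, fun _ hv => ⟨(h.link hv).1, (h.link hv).sconn⟩⟩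

/-- A normal 3-pseudomanifold that is not a manifold has a vertex link of Euler characteristic
different from 2. -/
theorem NormalPM.exists_eulerChar_ne (h : NormalPM K 3) (hn : ¬ Comb3Mfd K) :
    ∃ v, {v} ∈ K ∧ eulerChar (NPM.link K {v}) ≠ 2 := by
  by_contra! hc
  exact hn ⟨⟨h.1, h.sconn⟩, fun v hv => ⟨(h.link hv).comb2Mfd, (h.link hv).2.1, hc v hv⟩⟩

end

section

variable {α : Type*} [DecidableEq α]

/-- The simplex whose vertices are the images of the elements of the set `s` under `e`. -/
def simplex (e : ℕ → α) (s : ℕ) : Finset α := (bits s).image e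

/-- The complex with facet list `F`, its vertices labelled by `e`. -/
def cx (e : ℕ → α) (F : List ℕ) : Complex α := genCx ((F.map (simplex e)).toFinset)

/-- `F` lists distinct sets of `k` vertices less than `n`. -/
def Uniform (n k : ℕ) (F : List ℕ) : Prop :=
  F.Nodup ∧ ∀ s ∈ F, s < 2 ^ n ∧ (digits s).length = k

instance (n k : ℕ) (F : List ℕ) : Decidable (Uniform n k F) := inferInstanceAs (Decidable (_ ∧ _))

variable {e : ℕ → α} {n k : ℕ} {F : List ℕ}

theorem mem_cx {τ : Finset α} : τ ∈ cx e F ↔ τ.Nonempty ∧ ∃ s ∈ F, τ ⊆ simplex e s := by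
  simp [cx, genCx]
  tauto

theorem simplex_mono {s t : ℕ} (h : sub s t = true) : simplex e s ⊆ simplex e t :=
  Finset.image_subset_image (sub_iff.1 h)

theorem simplex_zero : simplex e 0 = ∅ := by simp [simplex, bits_zero]

theorem simplex_subset_iff (he : Set.InjOn e (Finset.range n)) {s t : ℕ} (hs : s < 2 ^ n)
    (ht : t < 2 ^ n) : simplex e s ⊆ simplex e t ↔ sub s t = true := by
  refine ⟨fun h => sub_iff.2 fun i hi => ?_, simplex_mono⟩
  obtain ⟨j, hj, hji⟩ := Finset.mem_image.1 (h (Finset.mem_image_of_mem e hi))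
  rwa [← he (bits_subset_range.2 ht hj) (bits_subset_range.2 hs hi) hji]

theorem simplex_injOn (he : Set.InjOn e (Finset.range n)) :
    Set.InjOn (simplex e) {s | s < 2 ^ n} := by
  intro s hs t ht h
  have h1 := (simplex_subset_iff he hs ht).1 h.le
  have h2 := (simplex_subset_iff he ht hs).1 h.ge
  rw [sub_iff] at h1 h2
  exact bits_injective (h1.antisymm h2)

theorem card_simplex (he : Set.InjOn e (Finset.range n)) {s : ℕ} (hs : s < 2 ^ n) :
    (simplex e s).card = (digits s).length := by
  rw [simplex, Finset.card_image_of_injOn (he.mono (by exact_mod_cast bits_subset_range.2 hs)),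
    card_bits]

theorem exists_simplex {σ : Finset α} (h : σ ⊆ (Finset.range n).image e) :
    ∃ s < 2 ^ n, simplex e s = σ := by
  obtain ⟨T, hT, rfl⟩ := Finset.subset_image_iff.1 h
  obtain ⟨s, rfl⟩ := exists_bits T
  exact ⟨s, bits_subset_range.1 (by exact_mod_cast hT), rfl⟩

theorem simplex_subset_image {s : ℕ} (hs : s < 2 ^ n) : simplex e s ⊆ (Finset.range n).image e :=
  Finset.image_subset_image (bits_subset_range.2 hs)

theorem simplex_congr {e' : ℕ → α} (h : Set.EqOn e e' (Finset.range n)) {s : ℕ} (hs : s < 2 ^ n) :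
    simplex e s = simplex e' s :=
  Finset.image_congr (h.mono (by exact_mod_cast bits_subset_range.2 hs))

theorem isComplex_cx (hF : F ≠ []) (hk : ∀ s ∈ F, s ≠ 0) : IsComplex (cx e F) := by
  refine ⟨?_, fun σ hσ => (mem_cx.1 hσ).1, fun σ hσ τ hτ hne => ?_⟩
  · obtain ⟨s, l, rfl⟩ := List.exists_cons_of_ne_nil hF
    exact ⟨simplex e s, mem_cx.2 ⟨(bits_nonempty.2 (hk s (by simp))).image e, s, by simp, subset_rfl⟩⟩
  · obtain ⟨-, s, hs, h⟩ := mem_cx.1 hσ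
    exact mem_cx.2 ⟨hne, s, hs, hτ.trans h⟩

theorem Uniform.card_eq (he : Set.InjOn e (Finset.range n)) (hF : Uniform n k F) {s : ℕ}
    (hs : s ∈ F) : (simplex e s).card = k := by
  rw [card_simplex he (hF.2 s hs).1, (hF.2 s hs).2]

theorem Uniform.mem_cx_of_card (he : Set.InjOn e (Finset.range n)) (hF : Uniform n k F)
    (hk : k ≠ 0) {τ : Finset α} (hτ : τ.card = k) : τ ∈ cx e F ↔ ∃ s ∈ F, τ = simplex e s := by
  rw [mem_cx]
  constructor
  · rintro ⟨-, s, hs, h⟩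
    exact ⟨s, hs, Finset.eq_of_subset_of_card_le h (by rw [hF.card_eq he hs, hτ])⟩
  · rintro ⟨s, hs, rfl⟩
    exact ⟨Finset.card_pos.1 (by omega), s, hs, subset_rfl⟩

/-- The number of facets containing a given face. -/
theorem Uniform.card_star (he : Set.InjOn e (Finset.range n)) (hF : Uniform n k F) (hk : k ≠ 0)
    {t : ℕ} (ht : t < 2 ^ n) :
    ((cx e F).filter fun τ => simplex e t ⊆ τ ∧ τ.card = k).card = F.countP (sub t) := by
  have h : (cx e F).filter (fun τ => simplex e t ⊆ τ ∧ τ.card = k) =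
      ((F.filter (sub t)).map (simplex e)).toFinset := by
    ext τ
    simp only [Finset.mem_filter, List.mem_toFinset, List.mem_map, List.mem_filter]
    constructor
    · rintro ⟨hτ, hs, hc⟩
      obtain ⟨s, hs', rfl⟩ := (hF.mem_cx_of_card he hk hc).1 hτ
      exact ⟨s, ⟨hs', (simplex_subset_iff he ht (hF.2 s hs').1).1 hs⟩, rfl⟩
    · rintro ⟨s, ⟨hs, hts⟩, rfl⟩
      have hc := hF.card_eq he hs
      exact ⟨(hF.mem_cx_of_card he hk hc).2 ⟨s, hs, rfl⟩, simplex_mono hts, hc⟩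
  rw [h, List.toFinset_card_of_nodup, List.length_map, List.countP_eq_length_filter]
  refine (hF.1.filter _).map_on fun s hs t ht => simplex_injOn he ?_ ?_
  · exact (hF.2 s (List.mem_of_mem_filter hs)).1
  · exact (hF.2 t (List.mem_of_mem_filter ht)).1

/-- A pure complex is determined by its facets. -/
theorem eq_cx_of_facets {K : Complex α} {d : ℕ} (hK : IsComplex K) (hp : IsPure K d)
    (hF : Uniform n (d + 1) F) (he : Set.InjOn e (Finset.range n))
    (h : ∀ τ, τ.card = d + 1 → (τ ∈ K ↔ ∃ s ∈ F, τ = simplex e s)) : K = cx e F := by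
  ext τ
  rw [mem_cx]
  constructor
  · intro hτ
    obtain ⟨σ, hσ, hs, hc⟩ := hp τ hτ
    obtain ⟨s, hs', rfl⟩ := (h σ hc).1 hσ
    exact ⟨hK.2.1 τ hτ, s, hs', hs⟩
  · rintro ⟨hne, s, hs, hτ⟩
    exact hK.2.2 _ ((h _ (hF.card_eq he hs)).2 ⟨s, hs, rfl⟩) τ hτ hne

theorem cx_congr_mask {F' : List ℕ} (h : mask F = mask F') : cx e F = cx e F' := by
  ext τ
  simp only [mem_cx, mask_eq_mask.1 h]

theorem cx_image {β : Type*} [DecidableEq β] (f : α → β) :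
    (cx e F).image (fun σ => σ.image f) = cx (f ∘ e) F := by
  ext τ
  simp only [Finset.mem_image, mem_cx, simplex, ← Finset.image_image]
  constructor
  · rintro ⟨σ, ⟨hne, s, hs, hσ⟩, rfl⟩
    exact ⟨hne.image f, s, hs, Finset.image_subset_image hσ⟩
  · rintro ⟨hne, s, hs, hτ⟩
    obtain ⟨σ, hσ, rfl⟩ := Finset.subset_image_iff.1 hτ
    exact ⟨σ, ⟨Finset.image_nonempty.1 hne, s, hs, by exact_mod_cast hσ⟩, rfl⟩

theorem cx_congr {e' : ℕ → α} (h : Set.EqOn e e' (Finset.range n)) (hF : ∀ s ∈ F, s < 2 ^ n) :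
    cx e F = cx e' F := by
  rw [cx, cx, List.map_congr_left fun s hs => simplex_congr h (hF s hs)]

theorem cx_relabel {q : List ℕ} (hF : ∀ s ∈ F, s < 2 ^ q.length) :
    cx e (F.map (relabel q)) = cx (fun i => e (q.getD i 0)) F := by
  rw [cx, cx, List.map_map]
  congr 2
  refine List.map_congr_left fun s hs => ?_
  simp only [Function.comp_apply, simplex, bits_relabel (hF s hs), Finset.image_image]
  rfl

end

/-- The family of ridges contained in an odd number of members of a list. -/
def once : List ℕ → ℕ
  | [] => 0
  | s :: F => once F ^^^ ridges s

/-- The family of ridges contained in at least two members of a list. -/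
def twice : List ℕ → ℕ
  | [] => 0
  | s :: F => twice F ||| (once F &&& ridges s)

/-- The family of ridges contained in some member of a list. -/
def shadow : List ℕ → ℕ
  | [] => 0
  | s :: l => shadow l ||| ridges s

/-- All extensions of `F` by members of `l` in which every ridge lies in no or two members,
provided no ridge lies in more than two members of `F`. -/
def search : List ℕ → List ℕ → List (List ℕ)
  | [], F => bif (once F).beq 0 then [F] else []
  | s :: l, F =>
    bif sub (once F) (shadow (s :: l)) then
      search l F ++ bif dis (twice F) (ridges s) then search l (s :: F) else []
    else []

/-- The number of members of `F` that contain `t` as a ridge. -/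
def ridgeCount (F : List ℕ) (t : ℕ) : ℕ := F.countP fun s => (ridges s).testBit t

theorem ridgeCount_cons (s : ℕ) (F : List ℕ) (t : ℕ) :
    ridgeCount (s :: F) t = ridgeCount F t + if (ridges s).testBit t then 1 else 0 :=
  List.countP_cons

theorem testBit_once {F : List ℕ} {t : ℕ} :
    (once F).testBit t = true ↔ ridgeCount F t % 2 = 1 := by
  induction F with
  | nil => simp [once, ridgeCount]
  | cons s F ih =>
    rw [once, Nat.testBit_xor, ridgeCount_cons]
    by_cases h : (ridges s).testBit t = true
    · simp only [h, Bool.xor_true, Bool.not_eq_true', ← Bool.not_eq_true, ih, if_true]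
      omega
    · simp [h, ih]

theorem testBit_twice {F : List ℕ} {t : ℕ} :
    (twice F).testBit t = true ↔ 2 ≤ ridgeCount F t := by
  induction F with
  | nil => simp [twice, ridgeCount]
  | cons s F ih =>
    rw [twice, Nat.testBit_or, Nat.testBit_and, ridgeCount_cons, Bool.or_eq_true, Bool.and_eq_true,
      ih, testBit_once]
    by_cases h : (ridges s).testBit t = true
    · simp only [h, if_true, and_true]
      omega
    · simp [h]

theorem testBit_shadow {l : List ℕ} {t : ℕ} :
    (shadow l).testBit t = true ↔ ∃ s ∈ l, (ridges s).testBit t = true := by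
  induction l with
  | nil => simp [shadow]
  | cons s l ih => simp [shadow, ih, or_comm]

theorem mem_search {c : ℕ → Bool} {l F : List ℕ}
    (h : ∀ t, ridgeCount ((l.filter c).reverse ++ F) t = 0 ∨
      ridgeCount ((l.filter c).reverse ++ F) t = 2) :
    (l.filter c).reverse ++ F ∈ search l F := by
  induction l generalizing F with
  | nil =>
    have h0 : once F = 0 := Nat.eq_of_testBit_eq fun t => by
      rw [Nat.zero_testBit, ← Bool.not_eq_true, testBit_once]
      have := h t
      simp only [List.filter_nil, List.reverse_nil, List.nil_append] at this
      omega
    simp [search, h0]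
  | cons s l ih =>
    have hadd : ∀ t, ridgeCount (((s :: l).filter c).reverse ++ F) t =
        ridgeCount ((s :: l).filter c) t + ridgeCount F t := fun t => by
      simp [ridgeCount, List.countP_append]
    have hsub : sub (once F) (shadow (s :: l)) = true := by
      refine sub_iff_testBit.2 fun t ht => ?_
      rw [testBit_once] at ht
      have hpos : 0 < ridgeCount ((s :: l).filter c) t := by
        have := h t
        rw [hadd] at this
        omega
      obtain ⟨r, hr, hrt⟩ := List.countP_pos_iff.1 hpos
      exact testBit_shadow.2 ⟨r, List.mem_of_mem_filter hr, hrt⟩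
    rw [search, hsub, cond_true, List.mem_append]
    by_cases hc : c s = true
    · right
      have heq : ((s :: l).filter c).reverse ++ F = (l.filter c).reverse ++ s :: F := by simp [hc]
      have hdis : dis (twice F) (ridges s) = true := by
        refine dis_iff_testBit.2 fun t ht hs => ?_
        rw [testBit_twice] at ht
        have := h t
        rw [hadd, List.filter_cons_of_pos hc, ridgeCount_cons, hs, if_pos rfl] at this
        omega
      rw [hdis, cond_true, heq]
      exact ih fun t => heq ▸ h t
    · left
      rw [List.filter_cons_of_neg hc] at h ⊢
      exact ih h

/-- The sets of `k` numbers less than `n`. -/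
def layer (n k : ℕ) : List ℕ :=
  (List.range (2 ^ n)).reverse.filter fun s => (digits s).length.beq k

theorem mem_layer {n k s : ℕ} : s ∈ layer n k ↔ s < 2 ^ n ∧ (digits s).length = k := by
  simp [layer]

theorem nodup_layer (n k : ℕ) : (layer n k).Nodup :=
  (List.nodup_reverse.2 List.nodup_range).filter _

/-- The lists of `k`-sets on `n + 1` vertices in which every ridge lies in no or two members and
the link of the vertex `n` is `L`. -/
def completions (n k : ℕ) (L : List ℕ) : List (List ℕ) :=
  search (layer n k) (L.map (2 ^ n + ·))

/-- A certificate for a list of facets: either a vertex set `r` splitting the link of a face `t`,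
or the image of the `i`-th list of a table under a relabelling `q`. -/
inductive Certificate
  | cut (t r : ℕ)
  | iso (i : ℕ) (q : List ℕ)

/-- The facets containing `t` fall into two nonempty classes, those within `r` and those meeting
`r` in `t`. -/
def separates (F : List ℕ) (t r : ℕ) : Bool :=
  sub t r && F.all (fun s => !sub t s || sub s r || sub (s &&& r) t) &&
    F.any (fun s => sub t s && sub s r && !sub s t) && F.any (fun s => sub t s && !sub s r)

/-- Validity of a certificate. -/
def certifies (n k : ℕ) (T : List (List ℕ)) (F : List ℕ) : Certificate → Bool
  | .cut t r => (digits t).length.beq k && separates F t r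
  | .iso i q => q.length.beq n && (mask q).beq (2 ^ n - 1) &&
      (mask ((T.getD i []).map (relabel q))).beq (mask F)

/-- `p` holds for corresponding entries of two lists, the first being no longer than the second. -/
def forallZip {α β : Type*} (p : α → β → Bool) : List α → List β → Bool
  | [], _ => true
  | a :: l, b :: m => p a b && forallZip p l m
  | _ :: _, [] => false

/-- Every completion of a list of `S` is skipped, disconnected somewhere or isomorphic to a list
of `T`. -/
def check (n k : ℕ) (skip : List ℕ → Bool) (T S : List (List ℕ)) (C : List (List Certificate)) :
    Bool :=
  forallZip (fun L c => forallZip (certifies (n + 1) (k - 2) T)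
    ((completions n k L).filter fun F => !skip F) c) S C

theorem forallZip.exists {α β : Type*} {p : α → β → Bool} {l : List α} {m : List β}
    (h : forallZip p l m = true) {a : α} (ha : a ∈ l) : ∃ b ∈ m, p a b = true := by
  induction l generalizing m with
  | nil => simp at ha
  | cons x l ih =>
    cases m with
    | nil => simp [forallZip] at h
    | cons y m =>
      rw [forallZip, Bool.and_eq_true] at h
      rcases List.mem_cons.1 ha with rfl | ha
      · exact ⟨y, by simp, h.1⟩
      · obtain ⟨b, hb, h'⟩ := ih h.2 ha
        exact ⟨b, by simp [hb], h'⟩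

theorem skip_or_certifies {n k : ℕ} {skip : List ℕ → Bool} {T S : List (List ℕ)}
    {C : List (List Certificate)} (h : check n k skip T S C = true) {L F : List ℕ} (hL : L ∈ S)
    (hF : F ∈ completions n k L) :
    skip F = true ∨ ∃ c, certifies (n + 1) (k - 2) T F c = true := by
  obtain ⟨c, -, hc⟩ := forallZip.exists h hL
  by_cases hs : skip F = true
  · exact .inl hs
  · obtain ⟨b, -, hb⟩ := forallZip.exists hc (List.mem_filter.2 ⟨hF, by simpa using hs⟩)
    exact .inr ⟨b, hb⟩

section

variable {α : Type*} [DecidableEq α] {e : ℕ → α} {n k : ℕ} {F : List ℕ}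

/-- A certificate of disconnectedness is sound. -/
theorem not_conn_of_separates (he : Set.InjOn e (Finset.range n)) (hF : ∀ s ∈ F, s < 2 ^ n)
    {t r : ℕ} (h : separates F t r = true) : ¬ Conn (link (cx e F) (simplex e t)) := by
  simp only [separates, Bool.and_eq_true, List.all_eq_true, List.any_eq_true, Bool.or_eq_true,
    Bool.not_eq_true'] at h
  obtain ⟨⟨⟨htr, hall⟩, s₁, hs₁, ⟨hts₁, hsr₁⟩, hst₁⟩, s₂, hs₂, hts₂, hsr₂⟩ := h
  rw [← Bool.not_eq_true, sub_iff] at hst₁ hsr₂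
  rw [sub_iff] at htr hts₁ hsr₁ hts₂
  have hlink : ∀ s ∈ F, bits t ⊆ bits s → ∀ i ∈ bits s, i ∉ bits t →
      {e i} ∈ link (cx e F) (simplex e t) := by
    intro s hs hts i hi hit
    have hn := bits_subset_range.2 (hF s hs)
    have hm : ({e i} : Finset α) ⊆ simplex e s :=
      Finset.singleton_subset_iff.2 (Finset.mem_image_of_mem e hi)
    refine mem_link.2 ⟨mem_cx.2 ⟨by simp, s, hs, hm⟩, ?_, mem_cx.2 ⟨by simp, s, hs,
      Finset.union_subset (Finset.image_subset_image hts) hm⟩⟩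
    rw [Finset.disjoint_singleton_left]
    intro hc
    obtain ⟨j, hj, hji⟩ := Finset.mem_image.1 hc
    exact hit (he (hn (hts hj)) (hn hi) hji ▸ hj)
  have ht : t < 2 ^ n := bits_subset_range.1 (hts₁.trans (bits_subset_range.2 (hF s₁ hs₁)))
  have hstep : ∀ a b, a ≠ b ∧ ({a, b} : Finset α) ∈ link (cx e F) (simplex e t) →
      (∃ i ∈ bits r, i < n ∧ e i = a) → ∃ i ∈ bits r, i < n ∧ e i = b := by
    rintro a b ⟨-, hab⟩ ⟨i, hi, hin, rfl⟩
    obtain ⟨-, hd, hu⟩ := mem_link.1 hab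
    obtain ⟨-, s, hs, hsub⟩ := mem_cx.1 hu
    have hn := bits_subset_range.2 (hF s hs)
    obtain ⟨i', hi', hii⟩ := Finset.mem_image.1 (hsub (by simp : e i ∈ _))
    obtain ⟨j, hj, rfl⟩ := Finset.mem_image.1 (hsub (by simp : b ∈ _))
    obtain rfl := he (hn hi') (by simpa using hin) hii
    have hts := (simplex_subset_iff he ht (hF s hs)).1 (Finset.subset_union_left.trans hsub)
    rcases hall s hs with (hc | hc) | hc
    · simp [hts] at hc
    · exact ⟨j, sub_iff.1 hc hj, by simpa using hn hj, rfl⟩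
    · rw [sub_iff, bits_and] at hc
      exact absurd (Finset.mem_image_of_mem e (hc (Finset.mem_inter.2 ⟨hi', hi⟩)))
        (Finset.disjoint_left.1 hd (by simp))
  obtain ⟨i, hi, hit⟩ := Finset.not_subset.1 hst₁
  obtain ⟨j, hj, hjr⟩ := Finset.not_subset.1 hsr₂
  have hmem : ∀ {x}, {x} ∈ link (cx e F) (simplex e t) → x ∈ verts (link (cx e F) (simplex e t)) :=
    fun h => subset_verts h (by simp)
  intro hconn
  have hpath := hconn.2 _ (hmem (hlink s₁ hs₁ hts₁ i hi hit)) _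
    (hmem (hlink s₂ hs₂ hts₂ j hj fun h => hjr (htr h)))
  have hend : ∀ {x}, Relation.ReflTransGen (fun a b => a ≠ b ∧ ({a, b} : Finset α) ∈
      link (cx e F) (simplex e t)) (e i) x → ∃ i' ∈ bits r, i' < n ∧ e i' = x := by
    intro x hx
    induction hx with
    | refl => exact ⟨i, hsr₁ hi, by simpa using bits_subset_range.2 (hF s₁ hs₁) hi, rfl⟩
    | tail _ hbc ih => exact hstep _ _ hbc ih
  obtain ⟨j', hj', hjn, heq⟩ := hend hpath
  exact hjr (he (by simpa using hjn) (bits_subset_range.2 (hF s₂ hs₂) hj) heq ▸ hj')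

end

section

variable {α : Type*} [DecidableEq α]

/-- `K` is a complex on the set `V` of size `n`, isomorphic to some member of the table `S`. -/
def Listed (n : ℕ) (V : Finset α) (S : List (List ℕ)) (K : Complex α) : Prop :=
  ∃ e : ℕ → α, Set.InjOn e (Finset.range n) ∧ (Finset.range n).image e = V ∧ ∃ L ∈ S, K = cx e L

theorem bits_two_pow_add {n s : ℕ} (h : s < 2 ^ n) : bits (2 ^ n + s) = insert n (bits s) := by
  ext i
  rw [Finset.mem_insert, mem_bits, mem_bits]
  rcases lt_trichotomy i n with hi | rfl | hi
  · rw [Nat.testBit_two_pow_add_gt hi]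
    simp [hi.ne]
  · rw [Nat.testBit_two_pow_add_eq, Nat.testBit_lt_two_pow h]
    simp
  · have : 2 ^ (n + 1) ≤ 2 ^ i := Nat.pow_le_pow_right two_pos hi
    rw [Nat.testBit_lt_two_pow, Nat.testBit_lt_two_pow]
    · simp [hi.ne']
    · rw [pow_succ] at this; omega
    · rw [pow_succ] at this; omega

theorem notMem_bits {n s : ℕ} (h : s < 2 ^ n) : n ∉ bits s := fun hn => by
  simpa using bits_subset_range.2 h hn

theorem length_digits_two_pow_add {n s : ℕ} (h : s < 2 ^ n) :
    (digits (2 ^ n + s)).length = (digits s).length + 1 := by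
  rw [← card_bits, ← card_bits, bits_two_pow_add h, Finset.card_insert_of_notMem (notMem_bits h)]

theorem Uniform.coned {n k : ℕ} {L A : List ℕ} (hL : Uniform n k L) (hA : Uniform n (k + 1) A) :
    Uniform (n + 1) (k + 1) (A ++ L.map (2 ^ n + ·)) := by
  refine ⟨List.nodup_append'.2 ⟨hA.1, hL.1.map (add_right_injective _), fun s hs ht => ?_⟩, ?_⟩
  · obtain ⟨t, -, rfl⟩ := List.mem_map.1 ht
    have := (hA.2 _ hs).1
    omega
  · intro s hs
    rw [pow_succ]
    rcases List.mem_append.1 hs with h | h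
    · have := hA.2 s h
      exact ⟨by omega, this.2⟩
    · obtain ⟨t, ht, rfl⟩ := List.mem_map.1 h
      have := hL.2 t ht
      exact ⟨by omega, by rw [length_digits_two_pow_add this.1, this.2]⟩

theorem simplex_update_add {e : ℕ → α} {v : α} {n s : ℕ} (h : s < 2 ^ n) :
    simplex (Function.update e n v) (2 ^ n + s) = insert v (simplex e s) := by
  rw [simplex, bits_two_pow_add h, Finset.image_insert, Function.update_self]
  congr 1
  refine Finset.image_congr fun i hi => Function.update_of_ne ?_ _ _
  rintro rfl
  exact notMem_bits h hi

theorem Uniform.ridgeCount_eq {n k : ℕ} {F : List ℕ} (hF : Uniform n (k + 1) F) {t : ℕ}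
    (ht : (digits t).length = k) : ridgeCount F t = F.countP (sub t) := by
  refine List.countP_congr fun s hs => ?_
  rw [testBit_ridges, card_bits, card_bits, ht, (hF.2 s hs).2, sub_iff]
  simp

/-- In a weak pseudomanifold every ridge lies in no or two facets. -/
theorem ridgeCount_eq_zero_or {d n : ℕ} {e : ℕ → α} {F : List ℕ} (hK : WeakPM (cx e F) (d + 1))
    (hF : Uniform n (d + 2) F) (he : Set.InjOn e (Finset.range n)) (t : ℕ) :
    ridgeCount F t = 0 ∨ ridgeCount F t = 2 := by
  rcases Nat.eq_zero_or_pos (ridgeCount F t) with h | h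
  · exact .inl h
  · right
    obtain ⟨s, hs, hst⟩ := List.countP_pos_iff.1 h
    rw [testBit_ridges, card_bits, card_bits, (hF.2 s hs).2] at hst
    have ht : t < 2 ^ n := bits_subset_range.1 (hst.1.trans (bits_subset_range.2 (hF.2 s hs).1))
    have hc : (digits t).length = d + 1 := by omega
    rw [hF.ridgeCount_eq hc, ← hF.card_star he (by omega) ht]
    refine hK.2.2 _ (mem_cx.2 ⟨?_, s, hs, Finset.image_subset_image hst.1⟩) ?_
    · rw [← Finset.card_pos, card_simplex he ht]
      omega
    · rw [card_simplex he ht, hc]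

/-- A normal pseudomanifold one of whose vertex links is known is found by the search. -/
theorem exists_mem_completions {K : Complex α} {d n : ℕ} {V : Finset α} {v : α} {e : ℕ → α}
    {L : List ℕ} (hK : WeakPM K (d + 1)) (hV : verts K ⊆ V) (hv : v ∈ V)
    (he : Set.InjOn e (Finset.range n)) (hi : (Finset.range n).image e = V.erase v)
    (hL : Uniform n (d + 1) L) (hl : link K {v} = cx e L) :
    ∃ e' : ℕ → α, Set.InjOn e' (Finset.range (n + 1)) ∧ (Finset.range (n + 1)).image e' = V ∧
      ∃ F ∈ completions n (d + 2) L, Uniform (n + 1) (d + 2) F ∧ K = cx e' F := by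
  set e' := Function.update e n v with he'
  have heq : Set.EqOn e' e (Finset.range n) := fun i hi =>
    Function.update_of_ne (by simp at hi; omega) _ _
  have hne : ∀ i < n, e i ≠ v := fun i hin h => by
    have := Finset.mem_image_of_mem e (Finset.mem_range.2 hin)
    rw [hi, h] at this
    simp at this
  have hinj : Set.InjOn e' (Finset.range (n + 1)) := by
    rw [Finset.range_add_one, Finset.coe_insert, Set.injOn_insert (by simp)]
    refine ⟨he.congr heq.symm, ?_⟩
    rintro ⟨i, hin, h⟩
    rw [heq hin, he', Function.update_self] at h
    exact hne i (by simpa using hin) h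
  have himg : (Finset.range (n + 1)).image e' = V := by
    rw [Finset.range_add_one, Finset.image_insert, Finset.image_congr heq, hi, he',
      Function.update_self, Finset.insert_erase hv]
  set A := ((layer n (d + 2)).filter fun s => decide (simplex e' s ∈ K)).reverse with hA
  have hAm : ∀ s, s ∈ A ↔ (s < 2 ^ n ∧ (digits s).length = d + 2) ∧ simplex e' s ∈ K := fun s => by
    simp [hA, mem_layer]
  have hU : Uniform (n + 1) (d + 2) (A ++ L.map (2 ^ n + ·)) :=
    hL.coned ⟨List.nodup_reverse.2 ((nodup_layer _ _).filter _), fun s hs => ((hAm s).1 hs).1⟩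
  have hKF : K = cx e' (A ++ L.map (2 ^ n + ·)) := by
    refine eq_cx_of_facets hK.1 hK.2.1 hU hinj fun τ hτ => ⟨fun hτK => ?_, ?_⟩
    · obtain ⟨s, hs, rfl⟩ := exists_simplex ((subset_verts hτK).trans (hV.trans himg.ge))
      rw [card_simplex hinj hs] at hτ
      refine ⟨s, List.mem_append.2 ?_, rfl⟩
      by_cases hsn : s < 2 ^ n
      · exact .inl ((hAm s).2 ⟨⟨hsn, hτ⟩, hτK⟩)
      · obtain ⟨r, rfl⟩ := Nat.exists_eq_add_of_le (not_lt.1 hsn)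
        have hr : r < 2 ^ n := by rw [pow_succ] at hs; omega
        rw [length_digits_two_pow_add hr] at hτ
        have hvr : v ∉ simplex e r := fun h => by
          have := simplex_subset_image (e := e) hr h
          rw [hi] at this
          simp at this
        have hcard : (simplex e r).card = d + 1 := by rw [card_simplex he hr]; omega
        have hmem : simplex e r ∈ cx e L := by
          rw [← hl, hK.1.mem_link_singleton, ← simplex_update_add hr]
          exact ⟨Finset.card_pos.1 (by omega), hvr, hτK⟩
        obtain ⟨r', hr', h⟩ := (hL.mem_cx_of_card he (by omega) hcard).1 hmem
        rw [simplex_injOn he hr (hL.2 r' hr').1 h]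
        exact .inr (List.mem_map_of_mem hr')
    · rintro ⟨s, hs, rfl⟩
      rcases List.mem_append.1 hs with h | h
      · exact ((hAm s).1 h).2
      · obtain ⟨r, hr, rfl⟩ := List.mem_map.1 h
        rw [simplex_update_add (hL.2 r hr).1]
        have := (hL.mem_cx_of_card he (by omega) (hL.card_eq he hr)).2 ⟨r, hr, rfl⟩
        rw [← hl, hK.1.mem_link_singleton] at this
        exact this.2.2
  exact ⟨e', hinj, himg, _, mem_search (ridgeCount_eq_zero_or (hKF ▸ hK) hU hinj), hU, hKF⟩

theorem mask_eq_two_pow_sub_one {n : ℕ} {q : List ℕ} (h : mask q = 2 ^ n - 1) (hq : q.length = n) :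
    Set.InjOn (q.getD · 0) (Finset.range n) ∧ (Finset.range n).image (q.getD · 0) = Finset.range n := by
  have hmem : q.toFinset = Finset.range n := by
    ext i
    rw [List.mem_toFinset, ← testBit_mask, h, Nat.testBit_two_pow_sub_one]
    simp
  have himg : (Finset.range n).image (q.getD · 0) = q.toFinset := by
    ext a
    simp only [Finset.mem_image, Finset.mem_range, List.mem_toFinset, List.mem_iff_getElem, ← hq]
    constructor
    · rintro ⟨i, hi, rfl⟩
      exact ⟨i, hi, by simp [hi]⟩
    · rintro ⟨i, hi, rfl⟩
      exact ⟨i, hi, by simp [hi]⟩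
  refine ⟨Finset.injOn_of_card_image_eq ?_, himg.trans hmem⟩
  rw [himg, hmem]

/-- Correctness of the inductive step of the enumeration. -/
theorem listed_of_check {K : Complex α} {d n : ℕ} {V : Finset α} {v : α} {skip : List ℕ → Bool}
    {T S : List (List ℕ)} {C : List (List Certificate)} (hc : check n (d + 2) skip T S C = true)
    (hS : ∀ L ∈ S, Uniform n (d + 1) L) (hT : ∀ F ∈ T, ∀ s ∈ F, s < 2 ^ (n + 1))
    (hK : NormalPM K (d + 1)) (hV : verts K ⊆ V) (hv : v ∈ V)
    (hl : Listed n (V.erase v) S (link K {v}))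
    (hskip : ∀ e F, Set.InjOn e (Finset.range (n + 1)) → (Finset.range (n + 1)).image e = V →
      Uniform (n + 1) (d + 2) F → K = cx e F → skip F = false) :
    Listed (n + 1) V T K := by
  obtain ⟨e₀, he₀, hi₀, L, hLS, hL⟩ := hl
  obtain ⟨e, he, hi, F, hF, hU, hKF⟩ := exists_mem_completions hK.1 hV hv he₀ hi₀ (hS L hLS) hL
  rcases skip_or_certifies hc hLS hF with h | ⟨⟨t, r⟩ | ⟨i, q⟩, h⟩
  · rw [hskip e F he hi hU hKF] at h
    contradiction
  · simp only [certifies, Bool.and_eq_true, Nat.beq_eq, Nat.add_sub_cancel] at h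
    refine absurd ?_ (not_conn_of_separates he (fun s hs => (hU.2 s hs).1) h.2)
    rcases Nat.eq_zero_or_pos t with rfl | ht
    · rw [simplex_zero, link_empty, ← hKF]
      exact hK.2.1
    · have h2 := h.2
      simp only [separates, Bool.and_eq_true, List.any_eq_true] at h2
      obtain ⟨s, hs, ⟨hts, -⟩, -⟩ := h2.1.2
      have ht' : t < 2 ^ (n + 1) :=
        bits_subset_range.1 ((sub_iff.1 hts).trans (bits_subset_range.2 (hU.2 s hs).1))
      rw [← hKF]
      refine hK.2.2 _ ?_ (by rw [card_simplex he ht', h.1])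
      rw [hKF, mem_cx]
      exact ⟨(bits_nonempty.2 ht.ne').image e, s, hs, simplex_mono hts⟩
  · simp only [certifies, Bool.and_eq_true, Nat.beq_eq] at h
    obtain ⟨⟨hlen, hq⟩, hm⟩ := h
    obtain ⟨hqi, hqr⟩ := mask_eq_two_pow_sub_one hq hlen
    have hi' : i < T.length := by
      by_contra hi'
      obtain ⟨σ, hσ⟩ := hK.1.1.1
      rw [hKF, ← cx_congr_mask hm, List.getD_eq_default _ _ (not_lt.1 hi'), mem_cx] at hσ
      simp at hσ
    rw [List.getD_eq_getElem _ _ hi'] at hm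
    refine ⟨fun i => e (q.getD i 0), he.comp hqi fun i hi => ?_, ?_, T[i], List.getElem_mem hi', ?_⟩
    · rw [← hqr]
      exact_mod_cast Finset.mem_image_of_mem (q.getD · 0) hi
    · rw [← hi]
      conv_rhs => rw [← hqr]
      rw [Finset.image_image]
      rfl
    · rw [hKF, ← cx_congr_mask hm, cx_relabel]
      rw [hlen]
      exact hT _ (List.getElem_mem hi')

end

/-- The number of sets of `k` vertices less than `n` contained in a member of `F`. -/
def numFaces (n : ℕ) (F : List ℕ) (k : ℕ) : ℕ := (layer n k).countP fun t => F.any (sub t)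

/-- The triangles in `F` form a surface of Euler characteristic 2. -/
def spherical (n : ℕ) (F : List ℕ) : Bool :=
  (numFaces n F 1 + F.length).beq (numFaces n F 2 + 2)

/-- Some number less than `n` belongs to no member of `F`. -/
def omits (n : ℕ) (F : List ℕ) : Bool := (List.range n).any fun i => F.all (dis (1 <<< i))

section

variable {α : Type*} [DecidableEq α]

theorem exists_enumeration {W : Finset α} {a b : α} (ha : a ∈ W) (hb : b ∈ W) (hab : a ≠ b) :
    ∃ e : ℕ → α, Set.InjOn e (Finset.range W.card) ∧ (Finset.range W.card).image e = W ∧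
      e 0 = a ∧ e 1 = b := by
  set l := a :: b :: ((W.erase a).erase b).toList with hl
  have hnd : l.Nodup := by simp [hl, hab, Finset.nodup_toList]
  have hmem : ∀ x, x ∈ l ↔ x ∈ W := fun x => by
    simp only [hl, List.mem_cons, Finset.mem_toList, Finset.mem_erase]
    by_cases h1 : x = a
    · simp [h1, ha]
    · by_cases h2 : x = b
      · simp [h2, hb]
      · simp [h1, h2]
  have hlen : l.length = W.card := by
    rw [← List.toFinset_card_of_nodup hnd]
    congr 1
    ext x
    rw [List.mem_toFinset, hmem]
  refine ⟨fun i => l.getD i a, ?_, ?_, rfl, rfl⟩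
  · intro i hi j hj hij
    simp only [Finset.coe_range, Set.mem_Iio, ← hlen] at hi hj
    simpa [hi, hj, hnd.getElem_inj_iff] using hij
  · ext x
    simp only [Finset.mem_image, Finset.mem_range, ← hmem, ← hlen, List.mem_iff_getElem]
    constructor
    · rintro ⟨i, hi, rfl⟩
      exact ⟨i, hi, by simp [hi]⟩
    · rintro ⟨i, hi, rfl⟩
      exact ⟨i, hi, by simp [hi]⟩

/-- Vertex links in a weak 1-pseudomanifold consist of two points. -/
theorem WeakPM.listed_link {K : Complex α} {n : ℕ} {V : Finset α} {v : α} (hK : WeakPM K 1)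
    (hv : {v} ∈ K) (hV : verts K ⊆ V) (hn : V.card = n + 3) :
    Listed (n + 2) (V.erase v) [[1, 2]] (NPM.link K {v}) := by
  obtain ⟨σ, τ, hστ, hst⟩ := Finset.card_eq_two.1 (hK.2.2 {v} hv (by simp))
  have hm : ∀ ρ, (ρ ∈ K ∧ {v} ⊆ ρ ∧ ρ.card = 1 + 1) ↔ ρ = σ ∨ ρ = τ := fun ρ => by
    simpa using congrArg (ρ ∈ ·) hst
  have hpt : ∀ ρ, ρ = σ ∨ ρ = τ → ∃ a, a ≠ v ∧ a ∈ V ∧ ρ = {v, a} := fun ρ hρ => by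
    obtain ⟨hρK, hs, hc⟩ := (hm ρ).2 hρ
    rw [Finset.singleton_subset_iff] at hs
    obtain ⟨a, ha⟩ := Finset.card_eq_one.1 (show (ρ.erase v).card = 1 by
      rw [Finset.card_erase_of_mem hs, hc])
    have haρ := Finset.mem_erase.1 (ha ▸ Finset.mem_singleton_self a : a ∈ ρ.erase v)
    exact ⟨a, haρ.1, hV (subset_verts hρK haρ.2), by rw [← Finset.insert_erase hs, ha]⟩
  obtain ⟨a, hav, haV, rfl⟩ := hpt σ (.inl rfl)
  obtain ⟨b, hbv, hbV, rfl⟩ := hpt τ (.inr rfl)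
  have hab : a ≠ b := by rintro rfl; exact hστ rfl
  have hvV : v ∈ V := hV (subset_verts hv (by simp))
  obtain ⟨e, he, hi, h0, h1⟩ := exists_enumeration (Finset.mem_erase.2 ⟨hav, haV⟩)
    (Finset.mem_erase.2 ⟨hbv, hbV⟩) hab
  have hcard : (V.erase v).card = n + 2 := by rw [Finset.card_erase_of_mem hvV, hn]; rfl
  rw [hcard] at he hi
  have hU : Uniform (n + 2) (0 + 1) [1, 2] := by
    refine ⟨by decide, ?_⟩
    have : 1 < 2 ^ (n + 2) ∧ 2 < 2 ^ (n + 2) := by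
      rw [pow_add]
      have := Nat.one_le_two_pow (n := n)
      omega
    simpa [this] using (by decide : (digits 1).length = 1 ∧ (digits 2).length = 1)
  have hs1 : simplex e 1 = {a} := by
    rw [← h0, simplex, show (1 : ℕ) = 1 <<< 0 from rfl, bits_shift, Finset.image_singleton]
  have hs2 : simplex e 2 = {b} := by
    rw [← h1, simplex, show (2 : ℕ) = 1 <<< 1 from rfl, bits_shift, Finset.image_singleton]
  have hmem : ∀ ρ : Finset α, ρ.card = 1 → (ρ ∈ NPM.link K {v} ↔ ρ = {a} ∨ ρ = {b}) := by
    intro ρ hρ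
    obtain ⟨c, rfl⟩ := Finset.card_eq_one.1 hρ
    have hm' := hm {v, c}
    rw [hK.1.mem_link_singleton, Finset.mem_singleton]
    simp only [Finset.singleton_inj]
    constructor
    · rintro ⟨-, hvc, hcK⟩
      have := hm'.1 ⟨hcK, by simp, Finset.card_pair hvc⟩
      rcases this with h | h
      · have : c ∈ ({v, a} : Finset α) := h ▸ (by simp)
        simp [Ne.symm hvc] at this
        exact .inl this
      · have : c ∈ ({v, b} : Finset α) := h ▸ (by simp)
        simp [Ne.symm hvc] at this
        exact .inr this
    · intro h
      refine ⟨by simp, ?_, ((hm {v, c}).2 (by rcases h with rfl | rfl <;> simp)).1⟩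
      rcases h with rfl | rfl
      · exact hav.symm
      · exact hbv.symm
  have hW := hK.link ⟨{a}, (hmem {a} (by simp)).2 (.inl rfl)⟩
  refine ⟨e, he, hi, [1, 2], by simp, eq_cx_of_facets hW.1 hW.2.1 hU he fun ρ hρ => ?_⟩
  rw [hmem ρ hρ]
  simp [hs1, hs2]

variable {e : ℕ → α} {n k : ℕ} {F : List ℕ}

theorem card_faces (he : Set.InjOn e (Finset.range n)) (hF : ∀ s ∈ F, s < 2 ^ n) (hk : k ≠ 0) :
    ((cx e F).filter fun τ => τ.card = k).card = numFaces n F k := by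
  have h : (cx e F).filter (fun τ => τ.card = k) =
      (((layer n k).filter fun t => F.any (sub t)).map (simplex e)).toFinset := by
    ext τ
    simp only [Finset.mem_filter, List.mem_toFinset, List.mem_map, List.mem_filter, mem_layer,
      List.any_eq_true, mem_cx]
    constructor
    · rintro ⟨⟨hne, s, hs, hτ⟩, rfl⟩
      obtain ⟨t, ht, rfl⟩ := exists_simplex (hτ.trans (simplex_subset_image (hF s hs)))
      exact ⟨t, ⟨⟨ht, (card_simplex he ht).symm⟩, s, hs, (simplex_subset_iff he ht (hF s hs)).1 hτ⟩, rfl⟩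
    · rintro ⟨t, ⟨⟨ht, rfl⟩, s, hs, hts⟩, rfl⟩
      have hc := card_simplex he ht
      exact ⟨⟨Finset.card_pos.1 (by omega), s, hs, simplex_mono hts⟩, hc⟩
  rw [h, List.toFinset_card_of_nodup, List.length_map, numFaces, List.countP_eq_length_filter]
  refine ((nodup_layer n k).filter _).map_on fun s hs t ht => simplex_injOn he ?_ ?_
  · exact (mem_layer.1 (List.mem_of_mem_filter hs)).1
  · exact (mem_layer.1 (List.mem_of_mem_filter ht)).1

theorem eulerChar_cx (he : Set.InjOn e (Finset.range n)) (hF : Uniform n 3 F) :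
    eulerChar (cx e F) = 2 ↔ spherical n F = true := by
  have h3 : ((cx e F).filter fun τ => τ.card = 3).card = F.length := by
    have := hF.card_star he (by decide) (t := 0) (by positivity)
    simp only [simplex_zero, Finset.empty_subset, true_and] at this
    rw [this, List.countP_eq_length]
    exact fun s _ => sub_iff.2 (by simp [bits_zero])
  have hlt := fun s hs => (hF.2 s hs).1
  rw [eulerChar, card_faces he hlt one_ne_zero, card_faces he hlt two_ne_zero, h3, spherical,
    Nat.beq_eq]
  omega

theorem mem_verts_cx {x : α} : x ∈ verts (cx e F) ↔ ∃ s ∈ F, x ∈ simplex e s := by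
  simp only [verts, Finset.mem_sup, id, mem_cx]
  constructor
  · rintro ⟨τ, ⟨-, s, hs, hτ⟩, hx⟩
    exact ⟨s, hs, hτ hx⟩
  · rintro ⟨s, hs, hx⟩
    exact ⟨{x}, ⟨by simp, s, hs, by simpa using hx⟩, by simp⟩

theorem verts_cx_ssubset (he : Set.InjOn e (Finset.range n)) (hF : ∀ s ∈ F, s < 2 ^ n)
    (h : omits n F = true) : verts (cx e F) ⊂ (Finset.range n).image e := by
  simp only [omits, List.any_eq_true, List.mem_range, List.all_eq_true] at h
  obtain ⟨i, hi, h⟩ := h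
  refine Finset.ssubset_iff_subset_ne.2 ⟨fun x hx => ?_, fun heq => ?_⟩
  · obtain ⟨s, hs, hx⟩ := mem_verts_cx.1 hx
    exact simplex_subset_image (hF s hs) hx
  · obtain ⟨s, hs, hx⟩ := mem_verts_cx.1 (heq ▸ Finset.mem_image_of_mem e (Finset.mem_range.2 hi))
    obtain ⟨j, hj, hji⟩ := Finset.mem_image.1 hx
    have := h s hs
    rw [dis_iff, bits_shift, Finset.disjoint_singleton_left] at this
    rw [he (bits_subset_range.2 (hF s hs) hj) (by simpa using hi) hji] at hj
    exact this hj

theorem verts_cx (hF : ∀ s ∈ F, s < 2 ^ n) (h : omits n F = false) :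
    verts (cx e F) = (Finset.range n).image e := by
  refine Finset.Subset.antisymm (fun x hx => ?_) fun x hx => ?_
  · obtain ⟨s, hs, hx⟩ := mem_verts_cx.1 hx
    exact simplex_subset_image (hF s hs) hx
  · obtain ⟨i, hi, rfl⟩ := Finset.mem_image.1 hx
    rw [← Bool.not_eq_true] at h
    simp only [omits, List.any_eq_true, List.mem_range, List.all_eq_true, dis_iff, bits_shift,
      Finset.disjoint_singleton_left, not_exists, not_and, not_forall, not_not] at h
    obtain ⟨s, hs, his⟩ := h i (by simpa using hi)
    exact mem_verts_cx.2 ⟨s, hs, Finset.mem_image_of_mem e his⟩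

end

/-- The facets of the link of `t`. -/
def starLink (F : List ℕ) (t : ℕ) : List ℕ := (F.filter (sub t)).map (· ^^^ t)

/-- Enlarge `a` successively by the members of a list that meet it. -/
def grow : List ℕ → ℕ → ℕ
  | [], a => a
  | s :: l, a => grow l (bif dis a s then a else a ||| s)

/-- Three rounds of growth from the first member of a list absorb all the others. -/
def connected : List ℕ → Bool
  | [] => true
  | s :: l => l.all (sub · (grow l (grow l (grow l s))))

/-- `F` is closed, all its links of codimension at least 2 are connected, its vertices are the
numbers less than `n`, and the link of the last vertex is not a sphere. -/
def singular (n : ℕ) (F : List ℕ) : Bool :=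
  ((layer n 3).all fun t => (F.countP (sub t)).beq 0 || (F.countP (sub t)).beq 2) &&
    ((layer n 0 ++ layer n 1 ++ layer n 2).all fun t => connected (starLink F t)) &&
    !omits n F && !spherical n (starLink F (1 <<< (n - 1)))

section

variable {n k : ℕ} {F : List ℕ}

theorem simplex_id (s : ℕ) : simplex id s = bits s := Finset.image_id

theorem starLink_uniform {m : ℕ} {t : ℕ} (hF : Uniform n (m + k) F) (ht : (digits t).length = m) :
    Uniform n k (starLink F t) := by
  refine ⟨(hF.1.filter _).map (Nat.xor_left_injective), fun s hs => ?_⟩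
  obtain ⟨r, hr, rfl⟩ := List.mem_map.1 hs
  rw [List.mem_filter, sub_iff] at hr
  have h := hF.2 r hr.1
  refine ⟨Nat.xor_lt_two_pow h.1 (bits_subset_range.1 (hr.2.trans (bits_subset_range.2 h.1))), ?_⟩
  rw [← card_bits, bits_xor_of_subset hr.2, Finset.card_sdiff_of_subset hr.2, card_bits, card_bits, h.2,
    ht, Nat.add_sub_cancel_left]

theorem link_cx {t : ℕ} : link (cx id F) (bits t) = cx id (starLink F t) := by
  ext τ
  simp only [mem_link, mem_cx, simplex_id, starLink, List.mem_map, List.mem_filter, sub_iff]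
  constructor
  · rintro ⟨⟨hne, -⟩, hd, -, s, hs, hu⟩
    have hts := Finset.subset_union_left.trans hu
    refine ⟨hne, _, ⟨s, ⟨hs, hts⟩, rfl⟩, ?_⟩
    rw [bits_xor_of_subset hts, Finset.subset_sdiff]
    exact ⟨Finset.subset_union_right.trans hu, hd⟩
  · rintro ⟨hne, _, ⟨s, ⟨hs, hts⟩, rfl⟩, hτ⟩
    rw [bits_xor_of_subset hts, Finset.subset_sdiff] at hτ
    exact ⟨⟨hne, s, hs, hτ.1⟩, hτ.2, hne.mono Finset.subset_union_right, s, hs,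
      Finset.union_subset hts hτ.1⟩

theorem grow_spec {p : ℕ → Prop} {l : List ℕ} {a : ℕ} (ha : ∀ i ∈ bits a, p i)
    (hl : ∀ s ∈ l, ∀ i ∈ bits s, p i → ∀ j ∈ bits s, p j) : ∀ i ∈ bits (grow l a), p i := by
  induction l generalizing a with
  | nil => exact ha
  | cons s l ih =>
    refine ih ?_ fun r hr => hl r (by simp [hr])
    rcases h : dis a s with _ | _
    · rw [← Bool.not_eq_true, dis_iff, Finset.not_disjoint_iff] at h
      obtain ⟨i, hia, his⟩ := h
      intro j hj
      rw [cond_false, bits_or, Finset.mem_union] at hj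
      exact hj.elim (ha j) (hl s (by simp) i his (ha i hia) j)
    · exact ha

theorem conn_cx (hF : F ≠ []) (h0 : ∀ s ∈ F, s ≠ 0) (h : connected F = true) : Conn (cx id F) := by
  obtain ⟨s, l, rfl⟩ := List.exists_cons_of_ne_nil hF
  simp only [connected, List.all_eq_true, sub_iff] at h
  obtain ⟨a, ha⟩ := bits_nonempty.2 (h0 s (by simp))
  set R : ℕ → ℕ → Prop := fun a b => a ≠ b ∧ ({a, b} : Finset ℕ) ∈ cx id (s :: l) with hR
  have hstep : ∀ r ∈ s :: l, ∀ i ∈ bits r, Relation.ReflTransGen R a i → ∀ j ∈ bits r,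
      Relation.ReflTransGen R a j := by
    intro r hr i hi hai j hj
    by_cases hij : i = j
    · exact hij ▸ hai
    · refine hai.tail ⟨hij, mem_cx.2 ⟨by simp, r, hr, ?_⟩⟩
      rw [simplex_id, Finset.insert_subset_iff, Finset.singleton_subset_iff]
      exact ⟨hi, hj⟩
  have hs : ∀ i ∈ bits s, Relation.ReflTransGen R a i := hstep s (by simp) a ha .refl
  have hl : ∀ r ∈ l, ∀ i ∈ bits r, Relation.ReflTransGen R a i → ∀ j ∈ bits r,
      Relation.ReflTransGen R a j := fun r hr => hstep r (by simp [hr])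
  have hreach : ∀ x ∈ verts (cx id (s :: l)), Relation.ReflTransGen R a x := by
    intro x hx
    obtain ⟨r, hr, hxr⟩ := mem_verts_cx.1 hx
    rw [simplex_id] at hxr
    rcases List.mem_cons.1 hr with rfl | hr
    · exact hs x hxr
    · exact grow_spec (grow_spec (grow_spec hs hl) hl) hl x (h r hr hxr)
  have hsymm : Std.Symm R := ⟨fun x y hxy => ⟨hxy.1.symm, by rw [Finset.pair_comm]; exact hxy.2⟩⟩
  exact ⟨⟨a, mem_verts_cx.2 ⟨s, by simp, by rwa [simplex_id]⟩⟩, fun u hu v hv =>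
    (Relation.ReflTransGen.stdSymm.symm _ _ (hreach u hu)).trans (hreach v hv)⟩

/-- Correctness of the test for normal 3-pseudomanifolds that are not manifolds. -/
theorem singular.spec (hF : Uniform (n + 1) 4 F) (h : singular (n + 1) F = true) :
    NormalPM (cx id F) 3 ∧ verts (cx id F) = Finset.range (n + 1) ∧ ¬ Comb3Mfd (cx id F) := by
  simp only [singular, Bool.and_eq_true, List.all_eq_true, Bool.or_eq_true, Nat.beq_eq,
    Bool.not_eq_true', Nat.add_sub_cancel, mem_layer, List.mem_append] at h
  obtain ⟨⟨⟨hr, hc⟩, ho⟩, hsp⟩ := h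
  have hid : Set.InjOn (id : ℕ → ℕ) (Finset.range (n + 1)) := Function.injective_id.injOn
  have hlt := fun s hs => (hF.2 s hs).1
  have hverts : verts (cx id F) = Finset.range (n + 1) := (verts_cx hlt ho).trans Finset.image_id
  have hne : F ≠ [] := by
    rintro rfl
    have : n ∈ verts (cx id []) := hverts ▸ by simp
    rw [mem_verts_cx] at this
    simp at this
  have hpos : ∀ {k : ℕ} {F : List ℕ}, Uniform (n + 1) (k + 1) F → ∀ s ∈ F, s ≠ 0 := by
    rintro k F hF s hs rfl
    have := (hF.2 0 hs).2
    rw [← card_bits, bits_zero] at this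
    simp at this
  have hK : IsComplex (cx id F) := isComplex_cx hne (hpos hF)
  have hlink : ∀ (t m : ℕ), t < 2 ^ (n + 1) → (digits t).length = m → m + 1 ≤ 3 →
      starLink F t ≠ [] → Conn (link (cx id F) (bits t)) := by
    intro t m ht hm hm3 hst
    rw [link_cx]
    obtain ⟨j, hj⟩ := Nat.exists_eq_add_of_le hm3
    refine conn_cx hst (hpos (starLink_uniform (m := m) (k := j + 1 + 1) ?_ hm)) (hc t ?_)
    · rwa [show m + (j + 1 + 1) = 4 by omega]
    · rcases (by omega : m = 0 ∨ m = 1 ∨ m = 2) with rfl | rfl | rfl <;> simp [ht, hm]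
  have hface : ∀ σ ∈ cx id F, ∃ t, t < 2 ^ (n + 1) ∧ bits t = σ ∧ starLink F t ≠ [] := by
    intro σ hσ
    obtain ⟨-, s, hs, hσ⟩ := mem_cx.1 hσ
    obtain ⟨t, ht, rfl⟩ := exists_simplex (hσ.trans (simplex_subset_image (hlt s hs)))
    refine ⟨t, ht, (simplex_id t).symm, fun hnil => ?_⟩
    rw [starLink, List.map_eq_nil_iff, List.filter_eq_nil_iff] at hnil
    exact hnil s hs ((simplex_subset_iff hid ht (hlt s hs)).1 hσ)
  have hconn : Conn (cx id F) := by
    rw [← link_empty (K := cx id F), ← bits_zero]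
    refine hlink 0 0 (by positivity) (by decide) (by decide) fun hnil => hne ?_
    rw [starLink, List.map_eq_nil_iff, List.filter_eq_nil_iff] at hnil
    exact List.eq_nil_iff_forall_not_mem.2 fun s hs =>
      hnil s hs (sub_iff.2 (by simp [bits_zero]))
  refine ⟨⟨⟨hK, fun σ hσ => ?_, fun σ hσ hcard => ?_⟩, hconn, fun σ hσ hcard => ?_⟩, hverts, ?_⟩
  · obtain ⟨hσ0, s, hs, hsub⟩ := mem_cx.1 hσ
    exact ⟨_, (hF.mem_cx_of_card hid (by decide) (hF.card_eq hid hs)).2 ⟨s, hs, rfl⟩, hsub,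
      hF.card_eq hid hs⟩
  · obtain ⟨t, ht, rfl, hst⟩ := hface σ hσ
    rw [← simplex_id, hF.card_star hid (by decide) ht]
    rw [card_bits] at hcard
    refine (hr t ⟨ht, hcard⟩).resolve_left fun h0 => hst ?_
    rw [starLink, List.map_eq_nil_iff, ← List.length_eq_zero_iff, ← List.countP_eq_length_filter, h0]
  · obtain ⟨t, ht, rfl, hst⟩ := hface σ hσ
    exact hlink t _ ht rfl (by rwa [← card_bits]) hst
  · intro hcomb
    have hn : {n} ∈ cx id F := hK.mem_verts.1 (hverts ▸ by simp)
    have := (hcomb.2 n hn).2.2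
    rw [← bits_shift n, link_cx, eulerChar_cx hid, hsp] at this
    · contradiction
    · exact starLink_uniform (m := 1) hF (by rw [← card_bits, bits_shift, Finset.card_singleton])

end

section

variable {α β : Type*} [DecidableEq α] [DecidableEq β]

/-- The number of tetrahedra of `K` containing `u` and `w`. -/
def pairDegree (K : Complex α) (u w : α) : ℕ :=
  (K.filter fun τ => {u, w} ⊆ τ ∧ τ.card = 4).card

/-- A numerical isomorphism invariant of complexes. -/
def invariant (K : Complex α) : ℕ :=
  ∑ u ∈ verts K, (∑ w ∈ verts K, pairDegree K u w ^ 3) ^ 2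

/-- The invariant in terms of a facet list on `n` vertices. -/
def listInvariant (n : ℕ) (F : List ℕ) : ℕ :=
  ((List.range n).map fun u =>
    ((List.range n).map fun w => F.countP (sub (1 <<< u ||| 1 <<< w)) ^ 3).sum ^ 2).sum

theorem Iso.invariant_eq {K : Complex α} {L : Complex β} (h : Iso K L) :
    invariant K = invariant L := by
  obtain ⟨f, hf, rfl⟩ := h
  have hsub : ∀ {σ}, σ ∈ K → (σ : Set α) ⊆ verts K := fun h => by exact_mod_cast subset_verts h
  have hverts : verts (K.image fun σ => σ.image f) = (verts K).image f := by
    ext x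
    simp only [verts, Finset.mem_sup, Finset.mem_image, id]
    constructor
    · rintro ⟨_, ⟨σ, hσ, rfl⟩, hx⟩
      obtain ⟨a, ha, rfl⟩ := Finset.mem_image.1 hx
      exact ⟨a, ⟨σ, hσ, ha⟩, rfl⟩
    · rintro ⟨a, ⟨σ, hσ, ha⟩, rfl⟩
      exact ⟨_, ⟨σ, hσ, rfl⟩, Finset.mem_image_of_mem f ha⟩
  have hmem : ∀ {σ u}, σ ∈ K → u ∈ verts K → (f u ∈ σ.image f ↔ u ∈ σ) := by
    intro σ u hσ hu
    refine ⟨fun h => ?_, Finset.mem_image_of_mem f⟩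
    obtain ⟨a, ha, hau⟩ := Finset.mem_image.1 h
    rwa [← hf (hsub hσ ha) hu hau]
  have hinj : Set.InjOn (fun σ => σ.image f) (K : Set (Finset α)) := by
    intro σ hσ τ hτ hστ
    ext a
    by_cases ha : a ∈ verts K
    · rw [← hmem hσ ha, ← hmem hτ ha]
      exact Iff.of_eq (congrArg (f a ∈ ·) hστ)
    · exact iff_of_false (fun h => ha (hsub hσ h)) fun h => ha (hsub hτ h)
  have hdeg : ∀ u ∈ verts K, ∀ w ∈ verts K,
      pairDegree (K.image fun σ => σ.image f) (f u) (f w) = pairDegree K u w := by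
    intro u hu w hw
    rw [pairDegree, pairDegree, Finset.filter_image, Finset.card_image_of_injOn
      (hinj.mono fun σ hσ => (Finset.mem_filter.1 hσ).1)]
    congr 1
    refine Finset.filter_congr fun σ hσ => ?_
    rw [Finset.card_image_of_injOn (hf.mono (hsub hσ))]
    simp only [Finset.insert_subset_iff, Finset.singleton_subset_iff, hmem hσ hu, hmem hσ hw]
  rw [invariant, invariant, hverts, Finset.sum_image hf]
  refine Finset.sum_congr rfl fun u hu => ?_
  rw [Finset.sum_image hf]
  congr 1
  exact Finset.sum_congr rfl fun w hw => by rw [hdeg u hu w hw]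

theorem invariant_cx {n : ℕ} {F : List ℕ} (hF : Uniform n 4 F)
    (hv : verts (cx id F) = Finset.range n) : invariant (cx id F) = listInvariant n F := by
  have hsum : ∀ f : ℕ → ℕ, ∑ i ∈ Finset.range n, f i = ((List.range n).map f).sum := fun f => rfl
  rw [invariant, hv, listInvariant, ← hsum]
  refine Finset.sum_congr rfl fun u hu => ?_
  rw [← hsum]
  congr 1
  refine Finset.sum_congr rfl fun w hw => ?_
  have hbits : bits (1 <<< u ||| 1 <<< w) = {u, w} := by
    rw [bits_or, bits_shift, bits_shift, Finset.insert_eq]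
  rw [pairDegree, ← hF.card_star Function.injective_id.injOn (by decide), simplex_id, hbits]
  rw [← bits_subset_range, hbits, Finset.insert_subset_iff, Finset.singleton_subset_iff]
  exact ⟨hu, hw⟩

end

/-- The facets of the cycles with 3, 4, 5 and 6 vertices. -/
def circles : List (List ℕ) :=
  [[3, 33, 34],
   [5, 6, 33, 34],
   [6, 9, 12, 33, 34],
   [10, 12, 17, 20, 33, 34]]

/-- Certificates for the enumeration of the graphs with at most 6 vertices. -/
def circleCerts : List (List Certificate) :=
  [[.iso 0 [0, 1, 2, 3, 4, 5], .iso 1 [0, 1, 2, 3, 4, 5], .iso 1 [0, 1, 3, 2, 4, 5], .iso 2 [0,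
     1, 2, 3, 4, 5], .iso 2 [0, 1, 3, 2, 4, 5], .iso 1 [0, 1, 4, 2, 3, 5], .iso 2 [0, 1, 2, 4, 3,
     5], .iso 3 [0, 1, 2, 3, 4, 5], .iso 2 [0, 1, 4, 2, 3, 5], .iso 3 [0, 1, 2, 4, 3, 5], .iso 2
     [0, 1, 3, 4, 2, 5], .iso 3 [0, 1, 3, 2, 4, 5], .iso 2 [0, 1, 4, 3, 2, 5], .iso 3 [0, 1, 3, 4,
     2, 5], .iso 3 [0, 1, 4, 2, 3, 5], .iso 3 [0, 1, 4, 3, 2, 5], .cut 0 35]]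

/-- The facets of the nonspherical surfaces with at most 7 vertices. -/
def surfaces : List (List ℕ) :=
  [[7, 13, 22, 25, 26, 42, 44, 49, 52, 67, 97, 98],
   [11, 13, 19, 22, 42, 44, 49, 52, 69, 70, 97, 98],
   [13, 22, 25, 26, 42, 44, 49, 52, 69, 70, 97, 98],
   [7, 11, 37, 42, 44, 70, 73, 76, 97, 98],
   [7, 11, 22, 25, 37, 44, 50, 56, 74, 76, 81, 84, 97, 98]]

/-- Certificates for the enumeration of the surfaces with at most 7 vertices. -/
def surfaceCerts : List (List Certificate) :=
  [[.cut 1 29, .cut 2 30, .iso 0 [0, 1, 2, 3, 4, 5, 6], .iso 0 [0, 1, 2, 4, 3, 5, 6], .iso 0 [0,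
     1, 3, 2, 4, 5, 6], .iso 0 [0, 1, 3, 4, 2, 5, 6], .iso 0 [0, 1, 4, 2, 3, 5, 6], .iso 0 [0, 1,
     4, 3, 2, 5, 6], .cut 32 99],
   [.cut 2 27, .cut 1 27, .cut 2 27, .iso 1 [0, 1, 2, 3, 4, 5, 6], .iso 2 [0, 1, 2, 3, 4, 5, 6],
     .cut 4 71, .cut 4 71, .cut 1 27, .iso 1 [0, 1, 2, 4, 3, 5, 6], .iso 2 [0, 1, 2, 4, 3, 5, 6],
     .cut 4 71, .cut 4 71, .iso 2 [2, 5, 0, 3, 4, 1, 6], .cut 2 27, .iso 2 [2, 5, 0, 4, 3, 1, 6],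
     .cut 1 27, .cut 2 27, .cut 1 27, .cut 32 99, .cut 32 99, .cut 32 99, .cut 32 99],
   [.cut 2 27, .cut 1 23, .iso 3 [0, 1, 2, 3, 4, 5, 6], .iso 0 [0, 1, 3, 6, 5, 2, 4], .iso 0 [0,
     1, 2, 5, 6, 3, 4], .iso 2 [0, 1, 2, 5, 6, 3, 4], .iso 2 [4, 6, 0, 2, 3, 1, 5], .cut 2 27,
     .iso 0 [0, 2, 1, 3, 6, 5, 4], .iso 2 [0, 2, 1, 3, 6, 5, 4], .iso 2 [4, 6, 3, 1, 2, 5, 0],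
     .cut 4 78, .cut 4 78, .iso 2 [4, 6, 0, 1, 5, 2, 3], .iso 2 [3, 5, 1, 0, 6, 2, 4], .cut 1 23,
     .cut 8 77, .cut 8 77, .iso 2 [2, 5, 0, 1, 6, 3, 4], .iso 2 [4, 6, 1, 0, 5, 3, 2], .cut 2 27,
     .cut 1 23, .iso 2 [1, 3, 0, 2, 6, 5, 4], .iso 2 [4, 6, 2, 0, 3, 5, 1], .iso 0 [1, 3, 0, 2, 6,
     5, 4], .cut 4 78, .cut 8 77, .iso 0 [2, 3, 6, 1, 0, 5, 4], .cut 32 99, .cut 32 99, .cut 32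
     99],
   [.iso 0 [0, 1, 2, 3, 4, 6, 5], .iso 1 [0, 1, 2, 3, 4, 6, 5], .iso 2 [0, 1, 2, 3, 4, 6, 5],
     .cut 4 39, .cut 4 39, .cut 2 23, .iso 0 [0, 2, 1, 3, 5, 6, 4], .iso 2 [0, 2, 1, 3, 5, 6, 4],
     .iso 2 [4, 5, 3, 1, 2, 6, 0], .cut 2 23, .cut 1 15, .cut 1 15, .iso 2 [1, 2, 0, 4, 5, 6, 3],
     .iso 0 [1, 2, 0, 4, 5, 6, 3], .iso 2 [3, 5, 4, 0, 2, 6, 1], .iso 2 [3, 4, 5, 0, 1, 6, 2],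
     .iso 1 [3, 4, 5, 0, 1, 6, 2], .iso 0 [4, 5, 3, 1, 2, 6, 0], .cut 8 78, .cut 16 85, .iso 0 [3,
     4, 5, 0, 1, 6, 2], .iso 4 [0, 1, 2, 3, 4, 5, 6], .cut 16 85, .cut 8 78, .iso 4 [0, 1, 4, 2,
     3, 6, 5], .iso 0 [3, 5, 4, 0, 2, 6, 1], .cut 32 99, .cut 32 99]]

/-- The facets of the 8-vertex normal 3-pseudomanifolds that are not manifolds. -/
def pseudomanifolds : List (List ℕ) :=
  [[23, 27, 43, 45, 53, 99, 135, 141, 150, 153, 154, 170, 172, 177, 180, 195, 225, 226],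
   [29, 30, 39, 46, 53, 99, 135, 141, 150, 153, 154, 170, 172, 177, 180, 195, 225, 226],
   [29, 30, 46, 53, 71, 101, 102, 135, 141, 150, 153, 154, 170, 172, 177, 180, 195, 225, 226],
   [45, 54, 57, 58, 71, 101, 102, 135, 141, 150, 153, 154, 170, 172, 177, 180, 195, 225, 226],
   [30, 57, 60, 71, 77, 78, 105, 106, 135, 141, 150, 153, 154, 170, 172, 177, 180, 195, 225,
     226],
   [23, 45, 53, 83, 89, 90, 105, 106, 135, 141, 150, 153, 154, 170, 172, 177, 180, 195, 225,
     226],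
   [45, 53, 71, 85, 86, 89, 90, 105, 106, 135, 141, 150, 153, 154, 170, 172, 177, 180, 195, 225,
     226],
   [57, 60, 71, 77, 86, 90, 92, 105, 106, 135, 141, 150, 153, 154, 170, 172, 177, 180, 195, 225,
     226],
   [27, 39, 43, 53, 77, 83, 85, 86, 102, 105, 108, 135, 141, 150, 153, 154, 170, 172, 177, 180,
     195, 225, 226],
   [23, 53, 77, 83, 89, 90, 101, 106, 108, 135, 141, 150, 153, 154, 170, 172, 177, 180, 195,
     225, 226],
   [29, 30, 71, 78, 85, 106, 108, 113, 116, 135, 141, 150, 153, 154, 170, 172, 177, 180, 195,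
     225, 226],
   [71, 77, 86, 89, 90, 106, 108, 113, 116, 135, 141, 150, 153, 154, 170, 172, 177, 180, 195,
     225, 226],
   [23, 43, 45, 53, 71, 99, 139, 141, 147, 150, 170, 172, 177, 180, 197, 198, 225, 226],
   [23, 29, 43, 57, 60, 71, 99, 139, 141, 147, 150, 170, 172, 177, 180, 197, 198, 225, 226],
   [30, 51, 58, 60, 75, 77, 78, 99, 139, 141, 147, 150, 170, 172, 177, 180, 197, 198, 225, 226],
   [27, 30, 57, 60, 77, 78, 105, 106, 139, 141, 147, 150, 170, 172, 177, 180, 197, 198, 225,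
     226],
   [29, 57, 60, 75, 83, 85, 86, 105, 106, 139, 141, 147, 150, 170, 172, 177, 180, 197, 198, 225,
     226],
   [27, 57, 60, 77, 86, 90, 92, 105, 106, 139, 141, 147, 150, 170, 172, 177, 180, 197, 198, 225,
     226],
   [29, 30, 57, 58, 75, 78, 83, 85, 105, 108, 114, 116, 139, 141, 147, 150, 170, 172, 177, 180,
     197, 198, 225, 226],
   [23, 27, 43, 45, 53, 71, 99, 141, 150, 153, 154, 170, 172, 177, 180, 197, 198, 225, 226],
   [15, 30, 43, 57, 60, 71, 99, 141, 150, 153, 154, 170, 172, 177, 180, 197, 198, 225, 226],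
   [27, 46, 51, 54, 75, 77, 78, 99, 141, 150, 153, 154, 170, 172, 177, 180, 197, 198, 225, 226],
   [51, 58, 60, 77, 83, 86, 89, 92, 99, 141, 150, 153, 154, 170, 172, 177, 180, 197, 198, 225,
     226],
   [29, 30, 46, 53, 101, 102, 141, 150, 153, 154, 170, 172, 177, 180, 197, 198, 225, 226],
   [30, 57, 60, 77, 78, 105, 106, 141, 150, 153, 154, 170, 172, 177, 180, 197, 198, 225, 226],
   [45, 53, 85, 86, 89, 90, 105, 106, 141, 150, 153, 154, 170, 172, 177, 180, 197, 198, 225,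
     226],
   [27, 43, 51, 54, 77, 102, 105, 108, 141, 150, 153, 154, 170, 172, 177, 180, 197, 198, 225,
     226],
   [54, 57, 58, 77, 102, 105, 108, 141, 150, 153, 154, 170, 172, 177, 180, 197, 198, 225, 226],
   [15, 23, 27, 78, 85, 106, 108, 113, 116, 141, 150, 153, 154, 170, 172, 177, 180, 197, 198,
     225, 226],
   [77, 86, 89, 90, 106, 108, 113, 116, 141, 150, 153, 154, 170, 172, 177, 180, 197, 198, 225,
     226],
   [15, 23, 43, 51, 78, 85, 89, 90, 105, 108, 114, 116, 141, 150, 153, 154, 170, 172, 177, 180,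
     197, 198, 225, 226],
   [23, 27, 53, 58, 60, 86, 89, 92, 113, 114, 135, 139, 165, 170, 172, 198, 201, 204, 225, 226],
   [23, 45, 51, 57, 75, 77, 85, 99, 135, 139, 150, 153, 165, 172, 178, 184, 202, 204, 209, 212,
     225, 226],
   [39, 54, 60, 75, 89, 92, 99, 135, 139, 150, 153, 165, 172, 178, 184, 202, 204, 209, 212, 225,
     226],
   [29, 30, 43, 46, 51, 53, 71, 77, 83, 90, 102, 105, 116, 120, 135, 139, 150, 153, 165, 172,
     178, 184, 202, 204, 209, 212, 225, 226]]

/-- Certificates for the enumeration of the 8-vertex normal 3-pseudomanifolds. -/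
def pseudomanifoldCerts : List (List Certificate) :=
  [[.iso 0 [0, 1, 2, 3, 4, 5, 6, 7], .iso 1 [0, 1, 2, 3, 4, 5, 6, 7], .iso 0 [1, 0, 2, 4, 3, 5,
     6, 7], .iso 0 [5, 0, 4, 2, 3, 1, 6, 7], .iso 1 [1, 5, 3, 4, 2, 0, 6, 7], .iso 1 [0, 5, 4, 3,
     2, 1, 6, 7], .cut 65 93, .cut 65 93, .cut 65 93, .cut 66 94, .cut 66 94, .iso 2 [0, 1, 2, 3,
     4, 5, 6, 7], .cut 3 59, .iso 3 [0, 1, 2, 3, 4, 5, 6, 7], .cut 6 151, .cut 36 103, .cut 5 143,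
     .cut 36 103, .cut 6 151, .cut 5 143, .cut 36 103, .cut 36 103, .iso 3 [1, 5, 3, 4, 2, 0, 6,
     7], .cut 34 55, .iso 2 [1, 5, 3, 4, 2, 0, 6, 7], .iso 4 [0, 1, 2, 3, 4, 5, 6, 7], .iso 5 [0,
     1, 2, 3, 4, 5, 6, 7], .cut 34 55, .iso 6 [0, 1, 2, 3, 4, 5, 6, 7], .cut 12 94, .cut 17 87,
     .iso 7 [0, 1, 2, 3, 4, 5, 6, 7], .cut 3 59, .iso 5 [5, 0, 4, 2, 3, 1, 6, 7], .cut 9 157, .cut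
     10 79, .iso 8 [0, 1, 2, 3, 4, 5, 6, 7], .iso 8 [1, 3, 5, 4, 6, 7, 2, 0], .cut 9 157, .iso 5
     [0, 5, 4, 3, 2, 1, 6, 7], .cut 34 55, .iso 4 [5, 1, 3, 2, 4, 0, 6, 7], .cut 5 143, .iso 9 [0,
     1, 2, 3, 4, 5, 6, 7], .cut 34 55, .cut 5 143, .cut 20 93, .iso 7 [5, 1, 3, 2, 4, 0, 6, 7],
     .cut 33 47, .iso 3 [0, 5, 4, 3, 2, 1, 6, 7], .iso 2 [0, 5, 4, 3, 2, 1, 6, 7], .iso 4 [1, 0,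
     2, 4, 3, 5, 6, 7], .cut 33 47, .iso 5 [1, 0, 2, 4, 3, 5, 6, 7], .iso 6 [1, 0, 2, 4, 3, 5, 6,
     7], .iso 7 [1, 0, 2, 4, 3, 5, 6, 7], .cut 10 79, .cut 20 93, .iso 4 [5, 0, 4, 2, 3, 1, 6, 7],
     .cut 6 151, .cut 33 47, .iso 5 [1, 5, 3, 4, 2, 0, 6, 7], .cut 33 47, .iso 9 [1, 0, 2, 4, 3,
     5, 6, 7], .iso 7 [5, 0, 4, 2, 3, 1, 6, 7], .cut 12 94, .cut 6 151, .iso 6 [0, 5, 4, 3, 2, 1,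
     6, 7], .iso 10 [0, 1, 2, 3, 4, 5, 6, 7], .iso 6 [1, 5, 3, 4, 2, 0, 6, 7], .iso 11 [0, 1, 2,
     3, 4, 5, 6, 7], .iso 7 [0, 5, 4, 3, 2, 1, 6, 7], .iso 7 [1, 5, 3, 4, 2, 0, 6, 7], .cut 18
     158, .cut 17 87, .cut 3 59, .iso 5 [5, 1, 3, 2, 4, 0, 6, 7], .iso 8 [1, 0, 2, 4, 3, 5, 6, 7],
     .iso 8 [0, 4, 5, 3, 6, 7, 2, 1], .cut 18 158, .cut 17 87, .cut 3 59, .iso 9 [5, 0, 4, 2, 3,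
     1, 6, 7], .cut 10 79, .cut 18 158, .cut 9 157, .iso 4 [0, 5, 4, 3, 2, 1, 6, 7], .iso 10 [1,
     5, 3, 4, 2, 0, 6, 7], .iso 4 [1, 5, 3, 4, 2, 0, 6, 7], .iso 10 [0, 5, 4, 3, 2, 1, 6, 7], .cut
     24 155, .cut 24 155, .iso 6 [5, 0, 4, 2, 3, 1, 6, 7], .cut 10 79, .cut 20 93, .cut 48 181,
     .cut 18 158, .cut 48 181, .cut 40 174, .cut 9 157, .cut 40 174, .cut 3 59, .cut 48 181, .cut
     5 143, .iso 8 [5, 1, 3, 2, 4, 0, 6, 7], .cut 48 181, .iso 8 [5, 0, 4, 2, 3, 1, 6, 7], .cut 6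
     151, .cut 40 174, .cut 40 174, .cut 17 87, .iso 6 [5, 1, 3, 2, 4, 0, 6, 7], .cut 12 94, .cut
     65 93, .cut 66 94, .cut 96 227, .cut 96 227],
   [.iso 12 [0, 1, 2, 3, 4, 5, 6, 7], .cut 3 155, .iso 12 [1, 0, 2, 4, 3, 5, 6, 7], .cut 3 155,
     .iso 13 [0, 1, 2, 3, 4, 5, 6, 7], .iso 13 [1, 0, 2, 4, 3, 5, 6, 7], .cut 5 55, .iso 13 [1, 5,
     0, 3, 6, 2, 4, 7], .iso 14 [0, 1, 2, 3, 4, 5, 6, 7], .iso 13 [0, 5, 1, 4, 6, 2, 3, 7], .cut 6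
     47, .iso 14 [1, 0, 2, 4, 3, 5, 6, 7], .cut 10 94, .cut 17 93, .cut 17 93, .iso 9 [7, 3, 1, 4,
     5, 6, 2, 0], .cut 10 94, .iso 9 [7, 4, 0, 3, 5, 6, 2, 1], .iso 12 [2, 0, 1, 6, 3, 5, 4, 7],
     .iso 13 [2, 5, 0, 3, 4, 1, 6, 7], .iso 12 [5, 0, 1, 6, 4, 2, 3, 7], .iso 13 [5, 2, 0, 4, 3,
     1, 6, 7], .cut 36 103, .cut 36 103, .cut 65 91, .cut 65 91, .iso 13 [0, 2, 1, 3, 6, 5, 4, 7],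
     .cut 34 55, .iso 14 [1, 0, 5, 3, 4, 2, 6, 7], .iso 15 [0, 1, 2, 3, 4, 5, 6, 7], .iso 14 [2,
     0, 1, 6, 3, 5, 4, 7], .iso 16 [0, 1, 2, 3, 4, 5, 6, 7], .cut 9 143, .iso 9 [7, 3, 2, 6, 5, 4,
     1, 0], .cut 12 94, .cut 9 143, .iso 17 [0, 1, 2, 3, 4, 5, 6, 7], .cut 5 55, .iso 13 [5, 1, 0,
     6, 3, 2, 4, 7], .iso 14 [1, 5, 0, 3, 6, 2, 4, 7], .cut 17 93, .cut 20 93, .iso 13 [2, 0, 1,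
     6, 3, 5, 4, 7], .iso 14 [0, 2, 1, 3, 6, 5, 4, 7], .cut 34 55, .cut 65 91, .iso 9 [7, 4, 5, 3,
     0, 6, 1, 2], .cut 33 47, .iso 13 [1, 2, 0, 4, 6, 5, 3, 7], .iso 14 [0, 1, 5, 4, 3, 2, 6, 7],
     .iso 14 [2, 1, 0, 6, 4, 5, 3, 7], .iso 16 [1, 0, 2, 4, 3, 5, 6, 7], .iso 15 [0, 1, 5, 4, 3,
     2, 6, 7], .cut 18 151, .iso 9 [7, 3, 5, 6, 2, 4, 0, 1], .iso 17 [1, 0, 2, 4, 3, 5, 6, 7],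
     .cut 20 93, .cut 18 151, .cut 33 47, .iso 13 [2, 1, 0, 6, 4, 5, 3, 7], .iso 14 [1, 2, 0, 4,
     6, 5, 3, 7], .iso 9 [7, 3, 5, 4, 1, 6, 0, 2], .cut 66 91, .iso 14 [0, 2, 5, 6, 3, 1, 4, 7],
     .iso 16 [2, 0, 1, 6, 3, 5, 4, 7], .iso 15 [0, 2, 5, 6, 3, 1, 4, 7], .iso 17 [2, 0, 1, 6, 3,
     5, 4, 7], .cut 68 199, .cut 68 199, .iso 13 [5, 0, 1, 6, 4, 2, 3, 7], .cut 6 47, .iso 14 [0,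
     5, 1, 4, 6, 2, 3, 7], .cut 12 94, .cut 10 94, .iso 18 [0, 1, 2, 3, 4, 5, 6, 7], .iso 14 [0,
     5, 2, 6, 4, 1, 3, 7], .iso 16 [5, 0, 1, 6, 4, 2, 3, 7], .cut 10 94, .cut 9 143, .cut 9 143,
     .cut 18 151, .iso 9 [7, 4, 1, 3, 2, 6, 5, 0], .iso 17 [1, 0, 5, 3, 4, 2, 6, 7], .iso 9 [7, 3,
     0, 4, 2, 6, 5, 1], .iso 17 [0, 1, 5, 4, 3, 2, 6, 7], .iso 9 [7, 3, 0, 6, 1, 4, 5, 2], .iso 17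
     [0, 2, 5, 6, 3, 1, 4, 7], .iso 9 [7, 4, 2, 3, 1, 6, 0, 5], .cut 66 91, .cut 20 93, .cut 9
     143, .cut 48 181, .cut 17 93, .cut 18 151, .cut 40 174, .cut 10 94, .cut 20 93, .cut 12 94,
     .iso 9 [7, 3, 1, 6, 0, 4, 2, 5], .cut 48 181, .cut 18 151, .cut 48 181, .cut 9 143, .cut 40
     174, .cut 40 174, .cut 65 91, .iso 9 [7, 3, 2, 4, 0, 6, 1, 5], .cut 12 94, .cut 17 93, .cut
     96 227, .cut 10 94, .cut 96 227, .cut 68 199, .cut 68 199],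
   [.iso 19 [0, 1, 2, 3, 4, 5, 6, 7], .iso 3 [0, 1, 5, 4, 3, 7, 6, 2], .iso 19 [1, 0, 2, 4, 3,
     5, 6, 7], .iso 3 [0, 1, 2, 3, 4, 7, 6, 5], .iso 20 [0, 1, 2, 3, 4, 5, 6, 7], .iso 20 [0, 1,
     5, 4, 3, 2, 6, 7], .cut 5 55, .iso 21 [0, 1, 2, 3, 4, 5, 6, 7], .iso 4 [1, 0, 5, 7, 4, 2, 6,
     3], .iso 21 [1, 0, 2, 4, 3, 5, 6, 7], .cut 6 47, .iso 4 [0, 1, 5, 7, 3, 2, 6, 4], .cut 5 55,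
     .iso 7 [4, 6, 3, 7, 2, 5, 0, 1], .iso 7 [3, 6, 4, 7, 2, 5, 1, 0], .cut 6 47, .cut 12 94, .cut
     10 79, .iso 22 [0, 1, 2, 3, 4, 5, 6, 7], .cut 20 93, .cut 17 87, .iso 22 [1, 0, 2, 4, 3, 5,
     6, 7], .iso 13 [7, 5, 0, 3, 4, 1, 6, 2], .iso 23 [0, 1, 2, 3, 4, 5, 6, 7], .iso 13 [7, 2, 0,
     4, 3, 1, 6, 5], .iso 23 [0, 1, 5, 4, 3, 2, 6, 7], .cut 36 103, .cut 36 103, .cut 65 91, .cut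
     65 91, .iso 21 [1, 0, 5, 3, 4, 2, 6, 7], .cut 34 55, .iso 4 [0, 1, 2, 7, 4, 5, 6, 3], .iso 24
     [0, 1, 2, 3, 4, 5, 6, 7], .iso 10 [3, 4, 7, 2, 5, 6, 1, 0], .iso 7 [4, 6, 3, 7, 5, 2, 1, 0],
     .cut 34 55, .iso 25 [0, 1, 2, 3, 4, 5, 6, 7], .cut 12 94, .iso 21 [6, 7, 4, 2, 0, 5, 1, 3],
     .cut 5 55, .iso 26 [0, 1, 2, 3, 4, 5, 6, 7], .iso 27 [0, 1, 2, 3, 4, 5, 6, 7], .iso 8 [2, 3,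
     7, 6, 4, 5, 1, 0], .cut 9 157, .iso 26 [1, 0, 5, 3, 4, 2, 6, 7], .iso 27 [1, 0, 5, 3, 4, 2,
     6, 7], .cut 34 55, .iso 5 [7, 6, 0, 3, 5, 4, 1, 2], .cut 33 47, .iso 21 [0, 1, 5, 4, 3, 2, 6,
     7], .iso 4 [1, 0, 2, 7, 3, 5, 6, 4], .iso 10 [3, 4, 7, 5, 2, 6, 0, 1], .iso 24 [0, 1, 5, 4,
     3, 2, 6, 7], .cut 33 47, .iso 7 [3, 6, 4, 7, 5, 2, 0, 1], .iso 25 [1, 0, 2, 4, 3, 5, 6, 7],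
     .iso 21 [6, 7, 3, 2, 1, 5, 0, 4], .cut 20 93, .cut 33 47, .iso 26 [0, 1, 5, 4, 3, 2, 6, 7],
     .iso 27 [0, 1, 5, 4, 3, 2, 6, 7], .iso 5 [7, 6, 1, 4, 5, 3, 0, 2], .iso 28 [0, 1, 2, 3, 4, 5,
     6, 7], .iso 14 [3, 7, 6, 5, 0, 4, 1, 2], .iso 17 [2, 0, 1, 7, 3, 5, 4, 6], .iso 29 [0, 1, 2,
     3, 4, 5, 6, 7], .cut 68 199, .cut 68 199, .iso 26 [1, 0, 2, 4, 3, 5, 6, 7], .cut 6 47, .iso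
     27 [1, 0, 2, 4, 3, 5, 6, 7], .cut 12 94, .iso 8 [2, 4, 7, 6, 3, 5, 0, 1], .cut 9 157, .cut 10
     79, .iso 28 [0, 1, 5, 4, 3, 2, 6, 7], .iso 14 [3, 7, 6, 2, 1, 4, 0, 5], .iso 30 [0, 1, 2, 3,
     4, 5, 6, 7], .cut 18 158, .cut 9 157, .iso 22 [0, 1, 5, 4, 3, 2, 6, 7], .iso 21 [6, 7, 4, 5,
     1, 2, 0, 3], .iso 22 [1, 0, 5, 3, 4, 2, 6, 7], .iso 21 [6, 7, 3, 5, 0, 2, 1, 4], .cut 24 155,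
     .cut 24 155, .iso 5 [7, 6, 1, 3, 2, 4, 0, 5], .cut 20 93, .cut 48 181, .cut 18 158, .cut 48
     181, .cut 40 174, .cut 9 157, .cut 40 174, .cut 24 155, .cut 10 79, .iso 8 [5, 3, 7, 6, 4, 2,
     0, 1], .cut 48 181, .iso 8 [5, 4, 7, 6, 3, 2, 1, 0], .cut 17 87, .cut 40 174, .iso 5 [7, 6,
     0, 4, 2, 3, 1, 5], .cut 12 94, .cut 10 79, .cut 96 227, .cut 17 87, .cut 96 227, .cut 68 199,
     .cut 68 199],
   [.cut 6 62, .iso 1 [1, 3, 7, 2, 6, 5, 4, 0], .iso 1 [2, 5, 7, 1, 6, 3, 4, 0], .iso 20 [3, 5,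
     1, 7, 6, 2, 4, 0], .iso 1 [0, 2, 7, 3, 6, 5, 4, 1], .cut 9 61, .iso 20 [2, 5, 0, 7, 6, 3, 4,
     1], .iso 1 [3, 5, 7, 0, 6, 2, 4, 1], .iso 1 [1, 2, 7, 3, 5, 6, 4, 0], .cut 5 93, .cut 3 143,
     .cut 3 143, .cut 5 93, .cut 10 94, .iso 1 [0, 3, 7, 2, 5, 6, 4, 1], .cut 3 143, .cut 10 94,
     .cut 3 143, .iso 1 [3, 6, 7, 1, 5, 2, 4, 0], .cut 6 62, .iso 20 [2, 3, 5, 7, 1, 6, 4, 0],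
     .iso 25 [7, 4, 1, 2, 5, 6, 3, 0], .iso 20 [2, 6, 1, 7, 5, 3, 4, 0], .iso 20 [3, 6, 0, 7, 5,
     2, 4, 1], .cut 3 143, .cut 3 143, .iso 25 [7, 4, 1, 3, 6, 5, 2, 0], .iso 25 [7, 4, 0, 2, 6,
     5, 3, 1], .iso 1 [2, 6, 7, 0, 5, 3, 4, 1], .cut 9 61, .iso 25 [7, 4, 0, 3, 5, 6, 2, 1], .iso
     20 [2, 3, 6, 7, 0, 5, 4, 1], .iso 1 [0, 1, 7, 5, 6, 3, 4, 2], .cut 33 59, .iso 20 [1, 3, 0,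
     7, 6, 5, 4, 2], .iso 1 [3, 5, 7, 6, 0, 1, 4, 2], .iso 1 [3, 6, 7, 5, 1, 0, 4, 2], .iso 20 [0,
     3, 1, 7, 5, 6, 4, 2], .cut 33 59, .iso 25 [7, 4, 5, 0, 1, 6, 3, 2], .cut 66 91, .cut 66 91,
     .iso 1 [0, 1, 7, 6, 5, 2, 4, 3], .iso 1 [2, 5, 7, 6, 1, 0, 4, 3], .iso 20 [0, 2, 1, 7, 6, 5,
     4, 3], .cut 34 55, .cut 65 87, .cut 65 87, .iso 20 [1, 2, 0, 7, 5, 6, 4, 3], .iso 1 [2, 6, 7,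
     5, 0, 1, 4, 3], .iso 25 [7, 4, 5, 1, 0, 6, 2, 3], .cut 34 55, .iso 1 [0, 2, 7, 6, 3, 1, 4,
     5], .iso 1 [1, 3, 7, 6, 2, 0, 4, 5], .iso 20 [0, 1, 2, 7, 6, 3, 4, 5], .cut 12 31, .iso 1 [1,
     2, 7, 5, 3, 0, 4, 6], .iso 1 [0, 3, 7, 5, 2, 1, 4, 6], .iso 20 [0, 1, 3, 7, 5, 2, 4, 6], .cut
     12 31, .iso 1 [5, 6, 7, 2, 3, 1, 4, 0], .cut 6 62, .iso 20 [1, 5, 3, 7, 2, 6, 4, 0], .iso 25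
     [7, 4, 2, 1, 3, 6, 5, 0], .iso 1 [5, 6, 7, 3, 2, 0, 4, 1], .iso 20 [0, 5, 2, 7, 3, 6, 4, 1],
     .cut 9 61, .iso 25 [7, 4, 3, 0, 2, 6, 5, 1], .iso 20 [1, 6, 2, 7, 3, 5, 4, 0], .cut 5 93,
     .iso 20 [5, 6, 0, 7, 3, 1, 4, 2], .iso 25 [7, 4, 2, 5, 6, 3, 1, 0], .cut 5 93, .iso 25 [7, 4,
     0, 1, 6, 3, 5, 2], .cut 10 94, .iso 20 [0, 6, 3, 7, 2, 5, 4, 1], .iso 25 [7, 4, 2, 6, 5, 3,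
     0, 1], .iso 20 [5, 6, 1, 7, 2, 0, 4, 3], .cut 10 94, .iso 25 [7, 4, 1, 0, 6, 2, 5, 3], .iso
     25 [7, 4, 3, 1, 2, 5, 6, 0], .iso 25 [7, 4, 2, 0, 3, 5, 6, 1], .iso 25 [7, 4, 1, 0, 5, 3, 6,
     2], .iso 25 [7, 4, 0, 1, 5, 2, 6, 3], .iso 25 [7, 4, 0, 2, 3, 1, 6, 5], .iso 31 [0, 1, 2, 3,
     4, 5, 6, 7], .cut 6 62, .cut 9 61, .iso 25 [7, 4, 0, 3, 2, 1, 5, 6], .iso 1 [0, 5, 7, 1, 3,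
     6, 4, 2], .cut 36 173, .cut 36 173, .cut 5 93, .cut 5 93, .iso 20 [0, 6, 5, 7, 1, 3, 4, 2],
     .iso 25 [7, 4, 1, 6, 3, 5, 0, 2], .cut 36 173, .cut 36 173, .iso 20 [3, 6, 2, 7, 1, 0, 4, 5],
     .iso 25 [7, 4, 1, 6, 0, 2, 3, 5], .cut 66 91, .cut 9 61, .cut 66 91, .iso 1 [0, 5, 7, 3, 1,
     2, 4, 6], .iso 20 [0, 2, 5, 7, 3, 1, 4, 6], .cut 34 55, .iso 25 [7, 4, 3, 2, 1, 5, 0, 6],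
     .cut 12 31, .cut 34 55, .cut 68 206, .cut 68 206, .iso 1 [1, 6, 7, 0, 3, 5, 4, 2], .cut 33
     59, .iso 25 [7, 4, 0, 5, 3, 6, 1, 2], .iso 20 [1, 5, 6, 7, 0, 3, 4, 2], .cut 68 206, .cut 10
     94, .cut 68 206, .cut 6 62, .cut 33 59, .iso 25 [7, 4, 0, 5, 1, 2, 3, 6], .cut 6 62, .iso 20
     [3, 5, 2, 7, 0, 1, 4, 6], .cut 65 87, .cut 65 87, .iso 20 [1, 2, 6, 7, 3, 0, 4, 5], .iso 1
     [1, 6, 7, 3, 0, 2, 4, 5], .iso 25 [7, 4, 3, 2, 0, 6, 1, 5], .cut 12 31, .iso 1 [0, 6, 7, 1,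
     2, 5, 4, 3], .iso 20 [0, 5, 6, 7, 1, 2, 4, 3], .iso 25 [7, 4, 1, 5, 2, 6, 0, 3], .cut 34 55,
     .cut 72 205, .cut 72 205, .cut 72 205, .cut 72 205, .cut 5 93, .cut 9 61, .iso 20 [2, 5, 3,
     7, 1, 0, 4, 6], .cut 9 61, .iso 25 [7, 4, 1, 5, 0, 3, 2, 6], .cut 34 55, .iso 1 [0, 6, 7, 2,
     1, 3, 4, 5], .iso 20 [0, 3, 6, 7, 2, 1, 4, 5], .iso 25 [7, 4, 2, 3, 1, 6, 0, 5], .cut 12 31,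
     .cut 66 91, .cut 66 91, .cut 40 174, .cut 40 174, .iso 1 [1, 5, 7, 0, 2, 6, 4, 3], .cut 10
     94, .cut 10 94, .cut 6 62, .cut 65 87, .cut 65 87, .cut 40 174, .cut 40 174, .iso 25 [7, 4,
     0, 6, 2, 5, 1, 3], .iso 20 [1, 6, 5, 7, 0, 2, 4, 3], .iso 25 [7, 4, 0, 6, 1, 3, 2, 5], .iso
     20 [2, 6, 3, 7, 0, 1, 4, 5], .cut 33 59, .iso 20 [1, 3, 5, 7, 2, 0, 4, 6], .cut 33 59, .iso
     25 [7, 4, 2, 3, 0, 5, 1, 6], .cut 12 31, .iso 1 [1, 5, 7, 2, 0, 3, 4, 6], .cut 40 174, .cut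
     40 174, .cut 36 173, .cut 36 173, .iso 1 [2, 3, 7, 0, 1, 6, 4, 5], .cut 68 206, .cut 68 206,
     .cut 72 205, .cut 72 205, .iso 1 [2, 3, 7, 1, 0, 5, 4, 6], .cut 96 227, .cut 96 227, .cut 96
     227, .cut 3 143, .cut 96 227, .cut 96 227, .cut 96 227],
   [.iso 32 [0, 1, 2, 3, 4, 5, 6, 7], .cut 5 93, .cut 5 93, .iso 8 [7, 0, 2, 3, 4, 1, 6, 5],
     .iso 8 [7, 0, 1, 4, 6, 3, 5, 2], .iso 8 [7, 1, 2, 5, 6, 4, 3, 0], .cut 3 143, .iso 32 [1, 0,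
     3, 2, 4, 6, 5, 7], .cut 3 143, .iso 8 [7, 1, 3, 2, 4, 0, 5, 6], .cut 10 62, .cut 17 55, .iso
     33 [0, 1, 2, 3, 4, 5, 6, 7], .cut 3 143, .iso 8 [7, 0, 3, 6, 5, 4, 2, 1], .cut 18 91, .cut 6
     151, .cut 6 151, .iso 32 [2, 0, 1, 5, 3, 4, 6, 7], .iso 8 [7, 3, 6, 5, 4, 2, 0, 1], .cut 10
     62, .cut 68 103, .cut 24 94, .cut 18 91, .iso 8 [7, 2, 5, 6, 4, 3, 1, 0], .cut 9 155, .cut 5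
     93, .cut 9 155, .cut 20 61, .iso 32 [3, 0, 4, 1, 6, 5, 2, 7], .cut 17 55, .cut 40 107, .iso 8
     [7, 0, 5, 1, 3, 2, 4, 6], .iso 8 [7, 5, 6, 4, 3, 1, 2, 0], .iso 8 [7, 1, 6, 0, 2, 3, 4, 5],
     .cut 33 59, .iso 33 [0, 2, 5, 1, 3, 6, 4, 7], .cut 12 31, .cut 33 59, .cut 66 87, .cut 65 79,
     .cut 20 61, .iso 33 [0, 3, 1, 4, 6, 2, 5, 7], .cut 34 47, .cut 20 61, .cut 24 94, .cut 24 94,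
     .iso 32 [4, 0, 6, 3, 5, 2, 1, 7], .cut 36 173, .cut 10 62, .cut 36 173, .cut 6 151, .iso 8
     [7, 1, 4, 6, 3, 5, 0, 2], .iso 32 [5, 0, 2, 6, 1, 3, 4, 7], .cut 48 117, .cut 12 31, .iso 8
     [7, 4, 6, 3, 5, 0, 1, 2], .iso 8 [7, 2, 4, 0, 5, 1, 3, 6], .iso 8 [7, 2, 6, 1, 0, 4, 5, 3],
     .iso 8 [7, 0, 6, 2, 1, 5, 3, 4], .iso 8 [7, 3, 4, 1, 6, 0, 2, 5], .iso 8 [7, 4, 5, 2, 6, 1,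
     0, 3], .iso 8 [7, 3, 5, 0, 1, 4, 6, 2], .iso 8 [7, 1, 5, 3, 0, 6, 2, 4], .cut 72 206, .cut 34
     47, .cut 9 155, .cut 5 93, .iso 8 [7, 0, 4, 5, 2, 6, 1, 3], .iso 32 [6, 0, 5, 4, 2, 1, 3, 7],
     .cut 80 213, .cut 12 31, .cut 6 151, .cut 36 173, .iso 34 [0, 1, 2, 3, 4, 5, 6, 7], .cut 9
     155, .iso 8 [7, 2, 3, 4, 1, 6, 0, 5], .cut 17 55, .cut 96 227, .cut 3 143, .cut 18 91]]

theorem check_circles : check 5 2 (fun _ => false) circles [[1, 2]] circleCerts = true := by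
  decide +kernel

theorem check_surfaces : check 6 3 (spherical 7) surfaces circles surfaceCerts = true := by
  decide +kernel

theorem check_pseudomanifolds :
    check 7 4 (omits 8) pseudomanifolds surfaces pseudomanifoldCerts = true := by
  decide +kernel

theorem uniform_circles : ∀ L ∈ circles, Uniform 6 2 L := by decide +kernel

theorem uniform_surfaces : ∀ L ∈ surfaces, Uniform 7 3 L := by decide +kernel

theorem uniform_pseudomanifolds : ∀ L ∈ pseudomanifolds, Uniform 8 4 L := by decide +kernel

theorem singular_pseudomanifolds : ∀ L ∈ pseudomanifolds, singular 8 L = true := by decide +kernel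

theorem nodup_listInvariant : (pseudomanifolds.map (listInvariant 8)).Nodup := by decide +kernel

section

variable {α : Type*} [DecidableEq α] {K : Complex α} {V : Finset α}

theorem NormalPM.exists_vertex {d : ℕ} (hK : NormalPM K d) : ∃ v, {v} ∈ K :=
  hK.2.1.1.imp fun _ => hK.1.1.mem_verts.1

theorem verts_link_subset {v : α} (hV : verts K ⊆ V) : verts (link K {v}) ⊆ V.erase v := by
  intro x hx
  obtain ⟨τ, hτ, hxτ⟩ := Finset.mem_sup.1 hx
  obtain ⟨hτK, hd, -⟩ := mem_link.1 hτ
  refine Finset.mem_erase.2 ⟨?_, hV (subset_verts hτK hxτ)⟩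
  rintro rfl
  exact Finset.disjoint_singleton_right.1 hd hxτ

/-- The classification of cycles with at most 6 vertices. -/
theorem NormalPM.listed_circles (hK : NormalPM K 1) (hV : verts K ⊆ V) (hcard : V.card = 6) :
    Listed 6 V circles K := by
  obtain ⟨v, hv⟩ := hK.exists_vertex
  exact listed_of_check check_circles (by decide +kernel)
    (fun F hF s hs => ((uniform_circles F hF).2 s hs).1) hK hV (hV (subset_verts hv (by simp)))
    (hK.1.listed_link hv hV hcard) fun _ _ _ _ _ _ => rfl

/-- The classification of nonspherical surfaces with at most 7 vertices. -/
theorem NormalPM.listed_surfaces (hK : NormalPM K 2) (hV : verts K ⊆ V) (hcard : V.card = 7)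
    (hχ : eulerChar K ≠ 2) : Listed 7 V surfaces K := by
  obtain ⟨v, hv⟩ := hK.exists_vertex
  have hvV : v ∈ V := hV (subset_verts hv (by simp))
  refine listed_of_check check_surfaces uniform_circles
    (fun F hF s hs => ((uniform_surfaces F hF).2 s hs).1) hK hV hvV
    ((hK.link hv).listed_circles (verts_link_subset hV)
      (by rw [Finset.card_erase_of_mem hvV, hcard])) fun e F he _ hF hKF => ?_
  rw [← Bool.not_eq_true, ← eulerChar_cx he hF, ← hKF]
  exact hχ

/-- The classification of 8-vertex normal 3-pseudomanifolds that are not manifolds. -/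
theorem NormalPM.listed_pseudomanifolds (hK : NormalPM K 3) (hcard : (verts K).card = 8)
    (hn : ¬ Comb3Mfd K) : Listed 8 (verts K) pseudomanifolds K := by
  obtain ⟨v, hv, hχ⟩ := hK.exists_eulerChar_ne hn
  have hvV : v ∈ verts K := subset_verts hv (by simp)
  refine listed_of_check check_pseudomanifolds uniform_surfaces
    (fun F hF s hs => ((uniform_pseudomanifolds F hF).2 s hs).1) hK subset_rfl hvV
    ((hK.link hv).listed_surfaces (verts_link_subset subset_rfl)
      (by rw [Finset.card_erase_of_mem hvV, hcard]) hχ) fun e F he hi hF hKF => ?_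
  rw [← Bool.not_eq_true]
  intro ho
  have := verts_cx_ssubset he (fun s hs => (hF.2 s hs).1) ho
  rw [← hKF, hi] at this
  exact this.ne rfl

/-- A listed complex is isomorphic to a complex on natural numbers. -/
theorem Listed.exists_iso {n : ℕ} {S : List (List ℕ)} (h : Listed n V S K)
    (hS : ∀ L ∈ S, ∀ s ∈ L, s < 2 ^ n) : ∃ L ∈ S, Iso K (cx id L) := by
  obtain ⟨e, he, -, L, hL, rfl⟩ := h
  have hinv : Set.EqOn (Function.invFunOn e (Finset.range n) ∘ e) id (Finset.range n) :=
    he.leftInvOn_invFunOn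
  refine ⟨L, hL, Function.invFunOn e (Finset.range n), ?_, ?_⟩
  · refine Set.InjOn.mono (fun x hx => ?_) (Function.invFunOn_injOn_image e (Finset.range n))
    obtain ⟨s, hs, hx⟩ := mem_verts_cx.1 hx
    exact_mod_cast simplex_subset_image (hS L hL s hs) hx
  · rw [cx_image, cx_congr hinv (hS L hL)]

end

end NPM

/-- up to isomorphism there are exactly 35 normal
3-pseudomanifolds on 8 vertices which are not combinatorial 3-manifolds. -/
theorem statement3 :
    ∃ L : List (NPM.Complex ℕ),
      L.length = 35 ∧
      (∀ X ∈ L, NPM.NormalPM X 3 ∧ (NPM.verts X).card = 8 ∧ ¬ NPM.Comb3Mfd X) ∧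
      L.Pairwise (fun X Y => ¬ NPM.Iso X Y) ∧
      (∀ (α : Type u) [DecidableEq α] (K : NPM.Complex α),
        NPM.NormalPM K 3 → (NPM.verts K).card = 8 → ¬ NPM.Comb3Mfd K →
          ∃ X ∈ L, NPM.Iso K X) := by
  have hspec := fun L hL => NPM.singular.spec (n := 7) (NPM.uniform_pseudomanifolds L hL)
    (NPM.singular_pseudomanifolds L hL)
  refine ⟨NPM.pseudomanifolds.map (NPM.cx id), rfl, ?_, ?_, ?_⟩
  · intro X hX
    obtain ⟨L, hL, rfl⟩ := List.mem_map.1 hX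
    obtain ⟨h, hv, hn⟩ := hspec L hL
    exact ⟨h, by rw [hv, Finset.card_range], hn⟩
  · rw [List.pairwise_map]
    refine (List.pairwise_map.1 NPM.nodup_listInvariant).imp_of_mem fun hL hM hne hiso => hne ?_
    rw [← NPM.invariant_cx (NPM.uniform_pseudomanifolds _ hL) (hspec _ hL).2.1,
      ← NPM.invariant_cx (NPM.uniform_pseudomanifolds _ hM) (hspec _ hM).2.1, hiso.invariant_eq]
  · intro α _ K hK hcard hn
    obtain ⟨L, hL, h⟩ := (hK.listed_pseudomanifolds hcard hn).exists_iso
      fun F hF s hs => ((NPM.uniform_pseudomanifolds F hF).2 s hs).1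
    exact ⟨_, List.mem_map_of_mem hL, h⟩
end

section
/- The four complexes S^3_{8,35}, S^3_{8,36}, S^3_{8,37}, S^3_{8,38} are pairwise properly bistellar equivalent, i.e., any one of them can be transformed into any other by a finite sequence of proper bistellar moves. -/
/-- The complex `S35` from the paper, generated by its facets. -/
def S35 : NPM.Complex ℕ :=
  NPM.genCx {{1,2,3,4}, {1,2,6,7}, {1,2,5,6}, {1,2,4,5}, {2,3,4,5}, {2,3,5,6}, {2,3,6,7}, {3,4,6,7}, {3,4,5,6}, {4,5,6,7}, {1,2,3,8}, {1,2,7,8}, {2,3,7,8}, {1,3,4,8}, {3,4,7,8}, {1,4,5,8}, {4,5,7,8}, {1,5,6,8}, {1,6,7,8}, {5,6,7,8}}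
/-- The complex `S36` from the paper, generated by its facets. -/
def S36 : NPM.Complex ℕ :=
  NPM.genCx {{1,2,3,4}, {1,2,5,6}, {1,2,4,5}, {1,5,6,7}, {2,3,4,5}, {2,3,5,6}, {2,3,6,7}, {3,4,6,7}, {3,4,5,6}, {4,5,6,7}, {1,2,6,8}, {1,6,7,8}, {2,6,7,8}, {1,2,3,8}, {2,3,7,8}, {1,3,4,8}, {3,4,7,8}, {1,4,5,8}, {1,5,7,8}, {4,5,7,8}}
/-- The complex `S37` from the paper, generated by its facets. -/
def S37 : NPM.Complex ℕ :=
  NPM.genCx {{1,2,3,4}, {1,2,5,6}, {1,2,4,5}, {1,4,5,7}, {2,3,4,5}, {2,3,5,6}, {2,3,6,7}, {3,4,6,7}, {3,4,5,6}, {4,5,6,7}, {1,5,6,8}, {1,5,7,8}, {5,6,7,8}, {1,2,6,8}, {2,6,7,8}, {1,2,3,8}, {2,3,7,8}, {1,3,4,8}, {1,4,7,8}, {3,4,7,8}}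
/-- The complex `S38` from the paper, generated by its facets. -/
def S38 : NPM.Complex ℕ :=
  NPM.genCx {{1,2,3,4}, {1,2,3,7}, {1,2,6,7}, {1,3,4,7}, {1,5,6,7}, {2,3,4,5}, {2,3,6,7}, {3,4,6,7}, {3,4,5,6}, {4,5,6,7}, {2,3,5,8}, {2,3,6,8}, {3,5,6,8}, {1,2,6,8}, {1,5,6,8}, {1,2,4,8}, {2,4,5,8}, {1,4,7,8}, {1,5,7,8}, {4,5,7,8}}

namespace NPM

section Flips

variable {α : Type*} [DecidableEq α]

theorem mem_genCx {F : Finset (Finset α)} {τ : Finset α} :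
    τ ∈ genCx F ↔ τ.Nonempty ∧ ∃ σ ∈ F, τ ⊆ σ := by
  simp only [genCx, Finset.mem_biUnion, Finset.mem_filter, Finset.mem_powerset]
  tauto

theorem facets_genCx {d : ℕ} {F : Finset (Finset α)} (hF : ∀ σ ∈ F, σ.card = d + 1) :
    facets (genCx F) d = F := by
  ext τ
  simp only [facets, Finset.mem_filter, mem_genCx]
  constructor
  · rintro ⟨⟨-, σ, hσ, hτσ⟩, hτ⟩
    rwa [Finset.eq_of_subset_of_card_le hτσ (by rw [hF σ hσ, hτ])]
  · intro hτ
    have hcard := hF τ hτ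
    exact ⟨⟨Finset.card_pos.mp (by omega), τ, hτ, subset_rfl⟩, hcard⟩

/-- The facet families `F` and `G` differ by replacing the star of `A`, whose facets are the
sets `(A ∪ B) \ {v}` with `v ∈ B`, by the star of `B`, whose facets are the sets
`(B ∪ A) \ {v}` with `v ∈ A`. The cardinality bounds make the bistellar move proper. -/
structure IsFlip (d : ℕ) (F G : Finset (Finset α)) (A B : Finset α) : Prop where
  card_left : ∀ σ ∈ F, σ.card = d + 1
  card_right : ∀ σ ∈ G, σ.card = d + 1
  disjoint : Disjoint A B
  two_le_left : 2 ≤ A.card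
  two_le_right : 2 ≤ B.card
  card_add : A.card + B.card = d + 2
  star_left : F.filter (A ⊆ ·) = B.image (A ∪ B).erase
  star_right : G.filter (B ⊆ ·) = A.image (B ∪ A).erase
  outside : F.filter (¬ A ⊆ ·) = G.filter (¬ B ⊆ ·)

theorem IsFlip.symm {d : ℕ} {F G : Finset (Finset α)} {A B : Finset α}
    (h : IsFlip d F G A B) : IsFlip d G F B A where
  card_left := h.card_right
  card_right := h.card_left
  disjoint := h.disjoint.symm
  two_le_left := h.two_le_right
  two_le_right := h.two_le_left
  card_add := by rw [add_comm, h.card_add]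
  star_left := h.star_right
  star_right := h.star_left
  outside := h.outside.symm

theorem IsFlip.mem_and_subset_iff {d : ℕ} {F G : Finset (Finset α)} {A B : Finset α}
    (h : IsFlip d F G A B) (σ : Finset α) :
    σ ∈ F ∧ A ⊆ σ ↔ ∃ v ∈ B, (A ∪ B).erase v = σ := by
  simpa using Finset.ext_iff.mp h.star_left σ

theorem IsFlip.notMem_genCx {d : ℕ} {F G : Finset (Finset α)} {A B : Finset α}
    (h : IsFlip d F G A B) : B ∉ genCx F := by
  rw [mem_genCx]
  rintro ⟨-, σ, hσ, hBσ⟩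
  by_cases hA : A ⊆ σ
  · obtain ⟨v, hv, rfl⟩ := (h.mem_and_subset_iff σ).mp ⟨hσ, hA⟩
    exact Finset.notMem_erase v _ (hBσ hv)
  · have hmem : σ ∈ G.filter (¬ B ⊆ ·) := h.outside ▸ Finset.mem_filter.mpr ⟨hσ, hA⟩
    exact (Finset.mem_filter.mp hmem).2 hBσ

theorem IsFlip.link_genCx {d : ℕ} {F G : Finset (Finset α)} {A B : Finset α}
    (h : IsFlip d F G A B) : link (genCx F) A = stdSphere B := by
  ext τ
  simp only [link, stdSphere, Finset.mem_filter, Finset.mem_powerset, mem_genCx]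
  constructor
  · rintro ⟨⟨hne, -⟩, hdisj, -, σ, hσ, hsub⟩
    rw [Finset.union_subset_iff] at hsub
    obtain ⟨v, hv, rfl⟩ := (h.mem_and_subset_iff σ).mp ⟨hσ, hsub.1⟩
    refine ⟨fun x hx => ?_, hne, ?_⟩
    · exact (Finset.mem_union.mp (Finset.mem_of_mem_erase (hsub.2 hx))).resolve_left
        (Finset.disjoint_left.mp hdisj hx)
    · rintro rfl
      exact Finset.notMem_erase v _ (hsub.2 hv)
  · rintro ⟨hsub, hne, hτB⟩
    obtain ⟨v, hv, hvτ⟩ := Finset.exists_of_ssubset (hsub.ssubset_of_ne hτB)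
    obtain ⟨hσ, hA⟩ := (h.mem_and_subset_iff _).mpr ⟨v, hv, rfl⟩
    have hτ : τ ⊆ (A ∪ B).erase v :=
      Finset.subset_erase.mpr ⟨hsub.trans Finset.subset_union_right, hvτ⟩
    exact ⟨⟨hne, _, hσ, hτ⟩, h.disjoint.symm.mono_left hsub, hne.mono Finset.subset_union_right,
      _, hσ, Finset.union_subset hA hτ⟩

theorem IsFlip.pMove {d : ℕ} {F G : Finset (Finset α)} {A B : Finset α}
    (h : IsFlip d F G A B) : PMove d (genCx F) (genCx G) := by
  have hA := h.two_le_left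
  have hB := h.two_le_right
  have hAB := h.card_add
  refine ⟨B.card - 1, by omega, by omega, A, B, ?_, by omega, by omega, h.notMem_genCx,
    h.link_genCx, ?_⟩
  · obtain ⟨v, hv⟩ : B.Nonempty := Finset.card_pos.mp (by omega)
    exact mem_genCx.mpr ⟨Finset.card_pos.mp (by omega), _, (h.mem_and_subset_iff _).mpr ⟨v, hv, rfl⟩⟩
  · rw [facets_genCx h.card_left, h.outside, ← h.star_right, Finset.union_comm,
      Finset.filter_union_filter_not_eq]

/-- Two facet families are related by a flip on some pair of faces. -/
def FlipRel (d : ℕ) (F G : Finset (Finset α)) : Prop := ∃ A B, IsFlip d F G A B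

instance flipRel_symm (d : ℕ) : Std.Symm (FlipRel (α := α) d) :=
  ⟨fun _ _ ⟨A, B, h⟩ => ⟨B, A, h.symm⟩⟩

theorem pEquiv_of_reflTransGen_flipRel {d : ℕ} {F G : Finset (Finset α)}
    (h : Relation.ReflTransGen (FlipRel d) F G) : PEquiv d (genCx F) (genCx G) :=
  h.lift genCx fun _ _ ⟨_, _, hAB⟩ => hAB.pMove

/-- The facet family obtained from `F` by replacing the star of `A` by that of `B`. -/
def flip (F : Finset (Finset α)) (A B : Finset α) : Finset (Finset α) :=
  F.filter (¬ A ⊆ ·) ∪ A.image (B ∪ A).erase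

theorem flipRel_flip {d : ℕ} {F : Finset (Finset α)} (A B : Finset α)
    (hF : ∀ σ ∈ F, σ.card = d + 1) (hdisj : Disjoint A B) (hA : 2 ≤ A.card) (hB : 2 ≤ B.card)
    (hcard : A.card + B.card = d + 2) (hstar : F.filter (A ⊆ ·) = B.image (A ∪ B).erase)
    (hBF : ∀ σ ∈ F, ¬ B ⊆ σ) : FlipRel d F (flip F A B) := by
  have hin : ∀ v ∈ A, B ⊆ (B ∪ A).erase v := fun v hv =>
    Finset.subset_erase.mpr ⟨Finset.subset_union_left, Finset.disjoint_left.mp hdisj hv⟩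
  refine ⟨A, B, hF, ?_, hdisj, hA, hB, hcard, hstar, ?_, ?_⟩
  · simp only [flip, Finset.mem_union, Finset.mem_filter, Finset.mem_image]
    rintro σ (⟨hσ, -⟩ | ⟨v, hv, rfl⟩)
    · exact hF σ hσ
    · rw [Finset.card_erase_of_mem (Finset.mem_union_right _ hv),
        Finset.card_union_of_disjoint hdisj.symm]
      omega
  all_goals
    ext σ
    simp only [flip, Finset.mem_union, Finset.mem_filter, Finset.mem_image]
    grind

end Flips

/-- Facets of `S35`. -/
def facets35 : Finset (Finset ℕ) :=
  {{1,2,3,4}, {1,2,6,7}, {1,2,5,6}, {1,2,4,5}, {2,3,4,5}, {2,3,5,6}, {2,3,6,7}, {3,4,6,7}, {3,4,5,6}, {4,5,6,7}, {1,2,3,8}, {1,2,7,8}, {2,3,7,8}, {1,3,4,8}, {3,4,7,8}, {1,4,5,8}, {4,5,7,8}, {1,5,6,8}, {1,6,7,8}, {5,6,7,8}}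
/-- Facets of `S36`. -/
def facets36 : Finset (Finset ℕ) :=
  {{1,2,3,4}, {1,2,5,6}, {1,2,4,5}, {1,5,6,7}, {2,3,4,5}, {2,3,5,6}, {2,3,6,7}, {3,4,6,7}, {3,4,5,6}, {4,5,6,7}, {1,2,6,8}, {1,6,7,8}, {2,6,7,8}, {1,2,3,8}, {2,3,7,8}, {1,3,4,8}, {3,4,7,8}, {1,4,5,8}, {1,5,7,8}, {4,5,7,8}}
/-- Facets of `S37`. -/
def facets37 : Finset (Finset ℕ) :=
  {{1,2,3,4}, {1,2,5,6}, {1,2,4,5}, {1,4,5,7}, {2,3,4,5}, {2,3,5,6}, {2,3,6,7}, {3,4,6,7}, {3,4,5,6}, {4,5,6,7}, {1,5,6,8}, {1,5,7,8}, {5,6,7,8}, {1,2,6,8}, {2,6,7,8}, {1,2,3,8}, {2,3,7,8}, {1,3,4,8}, {1,4,7,8}, {3,4,7,8}}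
/-- Facets of `S38`. -/
def facets38 : Finset (Finset ℕ) :=
  {{1,2,3,4}, {1,2,3,7}, {1,2,6,7}, {1,3,4,7}, {1,5,6,7}, {2,3,4,5}, {2,3,6,7}, {3,4,6,7}, {3,4,5,6}, {4,5,6,7}, {2,3,5,8}, {2,3,6,8}, {3,5,6,8}, {1,2,6,8}, {1,5,6,8}, {1,2,4,8}, {2,4,5,8}, {1,4,7,8}, {1,5,7,8}, {4,5,7,8}}

theorem flipRel_facets35_hub : FlipRel 3 facets35 (flip facets35 {1, 7} {2, 6, 8}) := by
  apply flipRel_flip <;> decide +kernel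

theorem flipRel_facets36_hub : FlipRel 3 facets36 (flip facets35 {1, 7} {2, 6, 8}) := by
  have hflip : flip facets36 {1, 7} {5, 6, 8} = flip facets35 {1, 7} {2, 6, 8} := by
    decide +kernel
  rw [← hflip]
  apply flipRel_flip <;> decide +kernel

theorem flipRel_facets37_hub : FlipRel 3 facets37 (flip facets35 {1, 7} {2, 6, 8}) := by
  have hflip : flip facets37 {1, 7} {4, 5, 8} = flip facets35 {1, 7} {2, 6, 8} := by
    decide +kernel
  rw [← hflip]
  apply flipRel_flip <;> decide +kernel

theorem reflTransGen_facets35_facets38 :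
    Relation.ReflTransGen (FlipRel 3) facets35 facets38 := by
  have hflip : flip (flip (flip (flip (flip (flip facets35 {2, 8} {1, 3, 7}) {1, 4, 5} {2, 8})
      {3, 8} {1, 4, 7}) {6, 8} {1, 5, 7}) {1, 2, 5} {6, 8}) {2, 5, 6} {3, 8} = facets38 := by
    decide +kernel
  rw [← hflip]
  refine .tail (.tail (.tail (.tail (.tail (.single
    (flipRel_flip _ _ ?_ ?_ ?_ ?_ ?_ ?_ ?_)) (flipRel_flip _ _ ?_ ?_ ?_ ?_ ?_ ?_ ?_))
    (flipRel_flip _ _ ?_ ?_ ?_ ?_ ?_ ?_ ?_)) (flipRel_flip _ _ ?_ ?_ ?_ ?_ ?_ ?_ ?_))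
    (flipRel_flip _ _ ?_ ?_ ?_ ?_ ?_ ?_ ?_)) (flipRel_flip _ _ ?_ ?_ ?_ ?_ ?_ ?_ ?_) <;>
    decide +kernel

end NPM

/-- `S^3_{8,35}, S^3_{8,36}, S^3_{8,37}, S^3_{8,38}` are pairwise
properly bistellar equivalent. -/
theorem statement5 :
    ∀ X ∈ ([S35, S36, S37, S38] : List (NPM.Complex ℕ)),
      ∀ Y ∈ ([S35, S36, S37, S38] : List (NPM.Complex ℕ)),
        NPM.PEquiv 3 X Y := by
  have h35 : Relation.ReflTransGen (NPM.FlipRel 3) NPM.facets35 NPM.facets35 := .refl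
  have h36 : Relation.ReflTransGen (NPM.FlipRel 3) NPM.facets35 NPM.facets36 :=
    .tail (.single NPM.flipRel_facets35_hub) (symm NPM.flipRel_facets36_hub)
  have h37 : Relation.ReflTransGen (NPM.FlipRel 3) NPM.facets35 NPM.facets37 :=
    .tail (.single NPM.flipRel_facets35_hub) (symm NPM.flipRel_facets37_hub)
  have hreach : ∀ X ∈ ([S35, S36, S37, S38] : List (NPM.Complex ℕ)),
      ∃ F, X = NPM.genCx F ∧ Relation.ReflTransGen (NPM.FlipRel 3) NPM.facets35 F := by
    simp only [List.forall_mem_cons]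
    exact ⟨⟨_, rfl, h35⟩, ⟨_, rfl, h36⟩, ⟨_, rfl, h37⟩,
      ⟨_, rfl, NPM.reflTransGen_facets35_facets38⟩, by simp⟩
  intro X hX Y hY
  obtain ⟨F, rfl, hF⟩ := hreach X hX
  obtain ⟨G, rfl, hG⟩ := hreach Y hY
  exact NPM.pEquiv_of_reflTransGen_flipRel
    ((symm hF).trans hG)
end
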